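/- arXiv:2312.12335 — 4 statements merged into one kernel-verified Lean document; each statement's English description precedes it below -/
import Mathlib

section
/- Let G be a group acting on ℂ^D through a homomorphism ρ : G →* (ℂ^D ≃ₗ[ℂ] ℂ^D), and let V ⊆ ℂ^D be a nonempty irreducible Zariski-closed G-invariant cone. Define apex V := {x ∈ V : x + V = V}, where x + V := {x + v : v ∈ V}. Then apex V is the carrier of a ℂ-linear subspace of ℂ^D, apex V ⊆ V, and ρ(g) '' (apex V) = apex V for every g ∈ G. -/
/-!
STATEMENT 0: the apex of an irreducible, closed, G-invariant cone `V ⊆ ℂ^D` is the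
carrier of a linear subspace, is contained in `V`, and is `G`-invariant.
-/

noncomputable section

/-- The Zariski topology on `ι → ℂ`: generated by complements of hypersurfaces,
so that a set is closed iff it is the common zero locus of a family of polynomials
in `MvPolynomial ι ℂ`. -/
def zt (ι : Type*) : TopologicalSpace (ι → ℂ) :=
  TopologicalSpace.generateFrom
    { U | ∃ f : MvPolynomial ι ℂ, U = { x | MvPolynomial.eval x f ≠ 0 } }

/-- Zariski-closedness. -/
def zIsClosed {ι : Type*} (S : Set (ι → ℂ)) : Prop := @IsClosed _ (zt ι) S

/-- Irreducibility for the Zariski topology. -/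
def zIsIrreducible {ι : Type*} (S : Set (ι → ℂ)) : Prop := @IsIrreducible _ (zt ι) S

/-- The apex `{x ∈ V : x + V = V}` of a set `V`, where `x + V = {x + v : v ∈ V}`. -/
def apexSet {ι : Type*} (V : Set (ι → ℂ)) : Set (ι → ℂ) :=
  { x ∈ V | (fun v => x + v) '' V = V }

theorem mem_apexSet_iff {ι : Type*} {V : Set (ι → ℂ)} {x : ι → ℂ} :
    x ∈ apexSet V ↔ x ∈ V ∧ ∀ v, x + v ∈ V ↔ v ∈ V := by
  refine and_congr_right fun _ => ⟨fun h v => ?_, fun h => ?_⟩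
  · conv_lhs => rw [← h]
    exact (add_right_injective x).mem_set_image
  · ext v
    constructor
    · rintro ⟨w, hw, rfl⟩
      exact (h w).2 hw
    · intro hv
      exact ⟨-x + v, (h _).1 (by simpa using hv), by simp⟩

/-- The apex of a nonempty cone, as a linear subspace. -/
def apexSubmodule {ι : Type*} (V : Set (ι → ℂ)) (hne : V.Nonempty)
    (hcone : ∀ (c : ℂ), ∀ x ∈ V, c • x ∈ V) : Submodule ℂ (ι → ℂ) where
  carrier := apexSet V
  zero_mem' := by
    obtain ⟨x, hx⟩ := hne
    exact mem_apexSet_iff.2 ⟨by simpa using hcone 0 x hx, by simp⟩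
  add_mem' := by
    intro x y hx hy
    rw [mem_apexSet_iff] at *
    exact ⟨(hx.2 y).2 hy.1, fun v => by rw [add_assoc, hx.2, hy.2]⟩
  smul_mem' := by
    intro c x hx
    rw [mem_apexSet_iff] at *
    refine ⟨hcone c x hx.1, fun v => ?_⟩
    rcases eq_or_ne c 0 with rfl | hc
    · simp
    · have smul_mem_iff (w : ι → ℂ) : c • w ∈ V ↔ w ∈ V :=
        ⟨fun h => by simpa [smul_smul, hc] using hcone c⁻¹ _ h, hcone c w⟩
      have hv : v = c • c⁻¹ • v := by simp [smul_smul, hc]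
      rw [hv, ← smul_add, smul_mem_iff, smul_mem_iff, hx.2]

/-- A linear automorphism preserving `V` preserves its apex. -/
theorem map_mem_apexSet {ι : Type*} {V : Set (ι → ℂ)} (e : (ι → ℂ) ≃ₗ[ℂ] (ι → ℂ))
    (he : ∀ x, e x ∈ V ↔ x ∈ V) {x : ι → ℂ} (hx : x ∈ apexSet V) : e x ∈ apexSet V := by
  rw [mem_apexSet_iff] at *
  refine ⟨(he x).2 hx.1, fun v => ?_⟩
  obtain ⟨w, rfl⟩ := e.surjective v
  rw [← map_add, he, he, hx.2]

theorem stmt_0 {D : ℕ} {G : Type*} [Group G]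
    (ρ : G →* ((Fin D → ℂ) ≃ₗ[ℂ] (Fin D → ℂ)))
    (V : Set (Fin D → ℂ))
    (hne : V.Nonempty)
    (hclosed : zIsClosed V)
    (hirr : zIsIrreducible V)
    (hcone : ∀ (c : ℂ), ∀ x ∈ V, c • x ∈ V)
    (hinv : ∀ (g : G), ∀ x ∈ V, ρ g x ∈ V) :
    (∃ W : Submodule ℂ (Fin D → ℂ), (W : Set (Fin D → ℂ)) = apexSet V) ∧
    apexSet V ⊆ V ∧
    ∀ g : G, (⇑(ρ g)) '' apexSet V = apexSet V := by
  have apply_inv (g : G) (x : Fin D → ℂ) : ρ g (ρ g⁻¹ x) = x := by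
    rw [← LinearEquiv.mul_apply, ← map_mul, mul_inv_cancel, map_one, LinearEquiv.coe_one, id]
  have mem_iff (g : G) (x : Fin D → ℂ) : ρ g x ∈ V ↔ x ∈ V := by
    refine ⟨fun h => ?_, hinv g x⟩
    have h' := hinv g⁻¹ _ h
    have hx := apply_inv g⁻¹ x
    rw [inv_inv] at hx
    rwa [hx] at h'
  refine ⟨⟨apexSubmodule V hne hcone, rfl⟩, fun x hx => hx.1, fun g => ?_⟩
  refine Set.Subset.antisymm ?_ fun x hx => ?_
  · rintro _ ⟨x, hx, rfl⟩
    exact map_mem_apexSet (ρ g) (mem_iff g) hx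
  · exact ⟨ρ g⁻¹ x, map_mem_apexSet (ρ g⁻¹) (mem_iff g⁻¹) hx, apply_inv g x⟩
end
end

section
/- Let G act on ℂ^D through ρ with ℂ^D an irreducible G-module, and let V ⊆ ℂ^D be an irreducible Zariski-closed G-invariant cone with V ≠ {0}. Fix m ≥ 1 and define apex (σ_m V) := {x ∈ σ_m V : x + σ_m V = σ_m V}. If apex (σ_m V) ≠ {0}, then σ_m V = ℂ^D. -/
/-!
STATEMENT 1: if `ℂ^D` is an irreducible `G`-module, `V` an irreducible closed
`G`-invariant cone with `V ≠ {0}`, `m ≥ 1`, and `apex (σ_m V) ≠ {0}`, then `σ_m V = ℂ^D`.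
-/

noncomputable section

/-- Zariski closure. -/
def zClosure {ι : Type*} (S : Set (ι → ℂ)) : Set (ι → ℂ) := @closure _ (zt ι) S

/-- The `m`-th secant variety: the Zariski closure of the set of sums of `m` points of `V`. -/
def secant {ι : Type*} (m : ℕ) (V : Set (ι → ℂ)) : Set (ι → ℂ) :=
  zClosure { p | ∃ x : Fin m → (ι → ℂ), (∀ i, x i ∈ V) ∧ p = ∑ i, x i }

/-- `ℂ^D` is an irreducible `G`-module (through `ρ`): `D ≥ 1` and the only
`ℂ`-subspaces invariant under all `ρ g` are `⊥` and `⊤`. -/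
def IsIrreducibleGModule {D : ℕ} {G : Type*} [Group G]
    (ρ : G →* ((Fin D → ℂ) ≃ₗ[ℂ] (Fin D → ℂ))) : Prop :=
  1 ≤ D ∧ ∀ W : Submodule ℂ (Fin D → ℂ),
    (∀ g : G, ∀ x ∈ W, ρ g x ∈ W) → W = ⊥ ∨ W = ⊤

/-- Linear maps are continuous for the Zariski topology. -/
theorem zt_continuous_linearMap {ι κ : Type*} [Fintype ι] [DecidableEq ι]
    (L : (ι → ℂ) →ₗ[ℂ] (κ → ℂ)) : @Continuous _ _ (zt ι) (zt κ) L := by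
  let _ := zt ι
  refine continuous_generateFrom_iff.2 ?_
  rintro _ ⟨f, rfl⟩
  refine TopologicalSpace.isOpen_generateFrom_of_mem
    ⟨MvPolynomial.bind₁ (fun k => ∑ j,
      MvPolynomial.C (L (fun i => if j = i then 1 else 0) k) * MvPolynomial.X j) f, ?_⟩
  ext x
  have hL : (fun k => MvPolynomial.eval x
      (∑ j, MvPolynomial.C (L (fun i => if j = i then 1 else 0) k) * MvPolynomial.X j)) = L x := by
    funext k
    conv_rhs => rw [LinearMap.pi_apply_eq_sum_univ L x]
    simp [mul_comm]
  have hf := MvPolynomial.eval₂Hom_bind₁ (RingHom.id ℂ) x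
    (fun k => ∑ j, MvPolynomial.C (L (fun i => if j = i then 1 else 0) k) * MvPolynomial.X j) f
  change MvPolynomial.eval x _ = MvPolynomial.eval (fun k => MvPolynomial.eval x _) f at hf
  rw [hL] at hf
  simp only [Set.mem_preimage, Set.mem_ofPred_eq, hf]

/-- A linear map preserving `V` preserves its secant varieties. -/
theorem map_mem_secant {ι : Type*} [Fintype ι] [DecidableEq ι] {V : Set (ι → ℂ)}
    (L : (ι → ℂ) →ₗ[ℂ] (ι → ℂ)) (hL : ∀ x ∈ V, L x ∈ V) (m : ℕ) {x : ι → ℂ}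
    (hx : x ∈ secant m V) : L x ∈ secant m V := by
  let _ := zt ι
  refine map_mem_closure (zt_continuous_linearMap L) hx ?_
  rintro _ ⟨y, hy, rfl⟩
  exact ⟨fun i => L (y i), fun i => hL _ (hy i), map_sum L y _⟩

/-- The vectors translating a cone `S` onto itself form a subspace. -/
def translationSubmodule {E : Type*} [AddCommGroup E] [Module ℂ E] (S : Set E)
    (hS : ∀ (c : ℂ), ∀ x ∈ S, c • x ∈ S) : Submodule ℂ E where
  carrier := { x | ∀ v, x + v ∈ S ↔ v ∈ S }
  zero_mem' v := by simp
  add_mem' {x y} hx hy v := by rw [add_assoc, hx, hy]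
  smul_mem' c x hx v := by
    rcases eq_or_ne c 0 with rfl | hc
    · simp
    have hunit : ∀ y, c • y ∈ S ↔ y ∈ S := fun y =>
      ⟨fun h => by simpa [smul_smul, hc] using hS c⁻¹ _ h, hS c y⟩
    have hv : c • (c⁻¹ • v) = v := smul_inv_smul₀ hc v
    rw [← hv, ← smul_add, hunit, hunit, hx]

theorem mem_translationSubmodule {E : Type*} [AddCommGroup E] [Module ℂ E] {S : Set E}
    {hS : ∀ (c : ℂ), ∀ x ∈ S, c • x ∈ S} {x : E} :
    x ∈ translationSubmodule S hS ↔ ∀ v, x + v ∈ S ↔ v ∈ S :=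
  Iff.rfl

/-- The apex of a cone containing the origin is its space of translations. -/
theorem apexSet_eq_translationSubmodule {ι : Type*} {S : Set (ι → ℂ)}
    (hS : ∀ (c : ℂ), ∀ x ∈ S, c • x ∈ S) (h0 : 0 ∈ S) :
    apexSet S = translationSubmodule S hS := by
  ext x
  rw [SetLike.mem_coe, mem_translationSubmodule]
  constructor
  · rintro ⟨-, h⟩ v
    conv_lhs => rw [← h]
    simp
  · intro h
    refine ⟨by simpa using (h 0).2 h0, ?_⟩
    ext v
    rw [Set.image_add_left, Set.mem_preimage, ← h, add_neg_cancel_left]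

theorem stmt_1 {D : ℕ} {G : Type*} [Group G]
    (ρ : G →* ((Fin D → ℂ) ≃ₗ[ℂ] (Fin D → ℂ)))
    (hmod : IsIrreducibleGModule ρ)
    (V : Set (Fin D → ℂ))
    (hclosed : zIsClosed V)
    (hirr : zIsIrreducible V)
    (hcone : ∀ (c : ℂ), ∀ x ∈ V, c • x ∈ V)
    (hinv : ∀ (g : G), ∀ x ∈ V, ρ g x ∈ V)
    (hV0 : V ≠ {0})
    (m : ℕ) (hm : 1 ≤ m)
    (hapex : apexSet (secant m V) ≠ {0}) :
    secant m V = Set.univ := by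
  have hcone' : ∀ (c : ℂ), ∀ x ∈ secant m V, c • x ∈ secant m V := fun c x hx =>
    map_mem_secant (c • LinearMap.id) (fun y hy => hcone c y hy) m hx
  have h0 : (0 : Fin D → ℂ) ∈ secant m V := by
    let _ := zt (Fin D)
    obtain ⟨x, hx⟩ := hirr.1
    exact subset_closure ⟨fun _ => 0, fun _ => by simpa using hcone 0 x hx, by simp⟩
  have hinv' : ∀ (g : G), ∀ x ∈ secant m V, ρ g x ∈ secant m V := fun g x hx =>
    map_mem_secant (ρ g).toLinearMap (hinv g) m hx
  have hiff : ∀ (g : G) (x : Fin D → ℂ), ρ g x ∈ secant m V ↔ x ∈ secant m V := fun g x =>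
    ⟨fun h => by simpa using hinv' g⁻¹ _ h, hinv' g x⟩
  rw [apexSet_eq_translationSubmodule hcone' h0] at hapex
  rcases hmod.2 (translationSubmodule _ hcone') (fun g x hx v => by
    have hv : ρ g (ρ g⁻¹ v) = v := by simp
    rw [← hv, ← map_add, hiff, hiff, hx]) with h | h
  · simp [h] at hapex
  · refine Set.eq_univ_of_forall fun x => ?_
    have hx : x ∈ translationSubmodule _ hcone' := h ▸ Submodule.mem_top
    simpa using (hx 0).2 h0
end
end

section
/- (Stationarity Lemma, tangent-map version.) Let G act on ℂ^D with ℂ^D an irreducible G-module, and let V, V' ⊆ ℂ^D be irreducible Zariski-closed G-invariant cones with V ≠ {0} and V' ≠ {0}. Let O ⊆ V and O' ⊆ V' be dense open subsets and N, N' : ℕ be such that finrank (T_x V) = N for all x ∈ O and finrank (T_y V') = N' for all y ∈ O'. Fix m ≥ 1 and a, a' : ℕ, and suppose there are dense open subsets W ⊆ V^m × V' and W' ⊆ V^{m+1} × V' such that: every ((x₁,…,x_m), y) ∈ W has all xᵢ ∈ O, y ∈ O' and finrank ((T_{x₁}V ⊔ ⋯ ⊔ T_{x_m}V) ⊓ T_y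 V') = a, and every ((x₁,…,x_{m+1}), y) ∈ W' has all xᵢ ∈ O, y ∈ O' and finrank ((T_{x₁}V ⊔ ⋯ ⊔ T_{x_{m+1}}V) ⊓ T_y V') = a'. If a' = a and a ≠ 0, then a = N' and there is a dense open subset of V^m on every point (x₁,…,x_m) of which T_{x₁}V ⊔ ⋯ ⊔ T_{x_m}V = ℂ^D. -/
/-!
STATEMENT 2: the Stationarity Lemma, tangent-map version.
-/

noncomputable section

def zIsOpen {ι : Type*} (S : Set (ι → ℂ)) : Prop := @IsOpen _ (zt ι) S

/-- `O` is a dense open subset of `S` (for the subspace topology on `S`). -/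
def IsDenseOpenSubset {ι : Type*} (O S : Set (ι → ℂ)) : Prop :=
  O ⊆ S ∧ (∃ U, zIsOpen U ∧ O = U ∩ S) ∧ S ⊆ zClosure O

/-- The embedded tangent space to `V ⊆ ℂ^D` at `x`: all `v` with
`∑ i, v i * eval x (pderiv i f) = 0` for every polynomial `f` vanishing on `V`. -/
def embTangent {D : ℕ} (V : Set (Fin D → ℂ)) (x : Fin D → ℂ) :
    Submodule ℂ (Fin D → ℂ) where
  carrier := { v | ∀ f : MvPolynomial (Fin D) ℂ,
    (∀ y ∈ V, MvPolynomial.eval y f = 0) →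
      ∑ i, v i * MvPolynomial.eval x (MvPolynomial.pderiv i f) = 0 }
  add_mem' := by
    intro a b ha hb f hf
    simp only [Pi.add_apply, add_mul, Finset.sum_add_distrib, ha f hf, hb f hf, add_zero]
  zero_mem' := by
    intro f hf
    simp
  smul_mem' := by
    intro c a ha f hf
    simp only [Pi.smul_apply, smul_eq_mul, mul_assoc, ← Finset.mul_sum, ha f hf, mul_zero]

/-- The `i`-th component of a point of the affine space `ℂ^(Fin k × Fin D)` of `k`-tuples. -/
def comp {k D : ℕ} (z : Fin k × Fin D → ℂ) (i : Fin k) : Fin D → ℂ := fun j => z (i, j)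

/-- The product `V^m × V'`, viewed inside the affine space of `(m+1)`-tuples. -/
def prodSet {D : ℕ} (m : ℕ) (V V' : Set (Fin D → ℂ)) : Set (Fin (m + 1) × Fin D → ℂ) :=
  { z | (∀ i : Fin m, comp z i.castSucc ∈ V) ∧ comp z (Fin.last m) ∈ V' }

/-- The power `V^m`, viewed inside the affine space of `m`-tuples. -/
def powSet {D : ℕ} (m : ℕ) (V : Set (Fin D → ℂ)) : Set (Fin m × Fin D → ℂ) :=
  { z | ∀ i : Fin m, comp z i ∈ V }

/-- The power `V^κ` inside the affine space of `κ`-indexed tuples. -/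
def tuples {D : ℕ} (κ : Type*) (V : Set (Fin D → ℂ)) : Set (κ × Fin D → ℂ) :=
  { z | ∀ k, (fun j => z (k, j)) ∈ V }

/-- The span of the tangent spaces to `V` at the members of a tuple. -/
def tangentSpan {D : ℕ} {κ : Type*} (V : Set (Fin D → ℂ)) (z : κ × Fin D → ℂ) :
    Submodule ℂ (Fin D → ℂ) :=
  ⨆ k, embTangent V (fun j => z (k, j))

/-- Pull a tuple back along a map of index types. -/
def reindex {D : ℕ} {κ l : Type*} (s : κ → l) (z : l × Fin D → ℂ) : κ × Fin D → ℂ :=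
  fun p => z (s p.1, p.2)

/-- Append a point to an `m`-tuple. -/
def appendPoint {m D : ℕ} (x : Fin m × Fin D → ℂ) (y : Fin D → ℂ) :
    Fin (m + 1) × Fin D → ℂ :=
  fun p => Fin.lastCases (motive := fun _ => ℂ) (y p.2) (fun i => x (i, p.2)) p.1

/-- Add a point to a tuple, indexed by `none`. -/
def optionPoint {D : ℕ} {κ : Type*} (z : κ × Fin D → ℂ) (y : Fin D → ℂ) :
    Option κ × Fin D → ℂ :=
  fun p => p.1.elim (y p.2) (fun k => z (k, p.2))

/-- Concatenate two tuples. -/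
def concat {D : ℕ} {κ l : Type*} (x : κ × Fin D → ℂ) (y : l × Fin D → ℂ) :
    (κ ⊕ l) × Fin D → ℂ :=
  fun p => p.1.elim (fun k => x (k, p.2)) (fun k => y (k, p.2))

/-- The index map which follows the right copy of `Fin m` below `k` and the left copy from
`k` on. -/
def mixedIndex (m k : ℕ) (i : Fin m) : Fin m ⊕ Fin m :=
  if i.val < k then Sum.inr i else Sum.inl i

/-- Apply a linear automorphism to each member of a tuple. -/
def mapTuple {D : ℕ} {κ : Type*} (e : (Fin D → ℂ) ≃ₗ[ℂ] (Fin D → ℂ))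
    (z : κ × Fin D → ℂ) : κ × Fin D → ℂ :=
  fun p => e (fun j => z (p.1, j)) p.2

section Zariski

attribute [local instance] zt

theorem zt_continuous_of_eval {ι κ : Type*} {φ : (ι → ℂ) → (κ → ℂ)}
    (p : κ → MvPolynomial ι ℂ) (h : ∀ x k, φ x k = MvPolynomial.eval x (p k)) :
    Continuous φ := by
  refine continuous_generateFrom_iff.2 ?_
  rintro _ ⟨f, rfl⟩
  refine TopologicalSpace.isOpen_generateFrom_of_mem ⟨MvPolynomial.bind₁ p f, ?_⟩
  ext x
  have hx : φ x = fun k => MvPolynomial.eval x (p k) := funext (h x)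
  simp only [Set.mem_preimage, Set.mem_ofPred_eq, hx]
  rw [← MvPolynomial.coe_aeval_eq_eval, ← MvPolynomial.coe_aeval_eq_eval]
  simp only [RingHom.coe_coe, MvPolynomial.aeval_bind₁]

theorem continuous_reindex {D : ℕ} {κ l : Type*} (s : κ → l) :
    Continuous (reindex (D := D) s) :=
  zt_continuous_of_eval (fun p => MvPolynomial.X (s p.1, p.2)) fun x k => by simp [reindex]

theorem continuous_appendPoint_left {m D : ℕ} (y : Fin D → ℂ) :
    Continuous fun x : Fin m × Fin D → ℂ => appendPoint x y :=
  zt_continuous_of_eval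
    (fun p => Fin.lastCases (motive := fun _ => MvPolynomial (Fin m × Fin D) ℂ)
      (MvPolynomial.C (y p.2)) (fun i => MvPolynomial.X (i, p.2)) p.1) fun x p => by
    obtain ⟨i, j⟩ := p
    induction i using Fin.lastCases <;> simp [appendPoint]

theorem continuous_appendPoint_right {m D : ℕ} (x : Fin m × Fin D → ℂ) :
    Continuous fun y : Fin D → ℂ => appendPoint x y :=
  zt_continuous_of_eval
    (fun p => Fin.lastCases (motive := fun _ => MvPolynomial (Fin D) ℂ)
      (MvPolynomial.X p.2) (fun i => MvPolynomial.C (x (i, p.2))) p.1) fun y p => by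
    obtain ⟨i, j⟩ := p
    induction i using Fin.lastCases <;> simp [appendPoint]

theorem continuous_optionPoint_left {D : ℕ} {κ : Type*} (y : Fin D → ℂ) :
    Continuous fun z : κ × Fin D → ℂ => optionPoint z y :=
  zt_continuous_of_eval
    (fun p => p.1.elim (MvPolynomial.C (y p.2)) (fun k => MvPolynomial.X (k, p.2)))
    fun x p => by rcases p with ⟨_ | k, j⟩ <;> simp [optionPoint]

theorem continuous_optionPoint_right {D : ℕ} {κ : Type*} (z : κ × Fin D → ℂ) :
    Continuous fun y : Fin D → ℂ => optionPoint z y :=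
  zt_continuous_of_eval
    (fun p => p.1.elim (MvPolynomial.X p.2) (fun k => MvPolynomial.C (z (k, p.2))))
    fun x p => by rcases p with ⟨_ | k, j⟩ <;> simp [optionPoint]

theorem continuous_concat_right {D : ℕ} {κ l : Type*} (x : κ × Fin D → ℂ) :
    Continuous fun y : l × Fin D → ℂ => concat x y :=
  zt_continuous_of_eval
    (fun p => p.1.elim (fun k => MvPolynomial.C (x (k, p.2)))
      (fun k => MvPolynomial.X (k, p.2)))
    fun x p => by rcases p with ⟨_ | k, j⟩ <;> simp [concat]

theorem linearEquiv_apply_eq_sum {D : ℕ} (e : (Fin D → ℂ) ≃ₗ[ℂ] (Fin D → ℂ))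
    (v : Fin D → ℂ) (j : Fin D) : e v j = ∑ i, v i * e (Pi.single i 1) j := by
  have h := LinearMap.pi_apply_eq_sum_univ e.toLinearMap v
  have h' := congrFun h j
  simp only [LinearEquiv.coe_coe, Finset.sum_apply, Pi.smul_apply, smul_eq_mul] at h'
  rw [h']
  refine Finset.sum_congr rfl fun i _ => ?_
  have hi : (fun k => if i = k then (1 : ℂ) else 0) = Pi.single i 1 := by
    ext k
    simp [Pi.single_apply, eq_comm]
  rw [hi]

theorem continuous_mapTuple {D : ℕ} {κ : Type*} (e : (Fin D → ℂ) ≃ₗ[ℂ] (Fin D → ℂ)) :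
    Continuous (mapTuple (κ := κ) e) :=
  zt_continuous_of_eval
    (fun p => ∑ i, MvPolynomial.X (p.1, i) * MvPolynomial.C (e (Pi.single i 1) p.2))
    fun x p => by
      rw [mapTuple, linearEquiv_apply_eq_sum]
      simp

theorem IsIrreducible.image2_of_separately_continuous {A B Z : Type*} [TopologicalSpace A]
    [TopologicalSpace B] [TopologicalSpace Z] {p : A → B → Z}
    (hleft : ∀ b, Continuous fun a => p a b) (hright : ∀ a, Continuous (p a))
    {S : Set A} {T : Set B} (hS : IsIrreducible S) (hT : IsIrreducible T) :
    IsIrreducible (Set.image2 p S T) := by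
  refine ⟨hS.1.image2 hT.1, ?_⟩
  have key : ∀ U : Set Z, IsOpen U → IsOpen {b | ∃ a ∈ S, p a b ∈ U} := by
    intro U hU
    have : {b | ∃ a ∈ S, p a b ∈ U} = ⋃ a ∈ S, p a ⁻¹' U := by ext; simp
    rw [this]
    exact isOpen_biUnion fun a _ => hU.preimage (hright a)
  rintro U U' hU hU' ⟨_, ⟨a, ha, b, hb, rfl⟩, h⟩ ⟨_, ⟨a', ha', b', hb', rfl⟩, h'⟩
  obtain ⟨b₀, hb₀, ⟨c, hc, hcU⟩, ⟨c', hc', hcU'⟩⟩ :=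
    hT.2 _ _ (key U hU) (key U' hU') ⟨b, hb, a, ha, h⟩ ⟨b', hb', a', ha', h'⟩
  obtain ⟨a₀, ha₀, h₀, h₀'⟩ := hS.2 _ _ (hU.preimage (hleft b₀)) (hU'.preimage (hleft b₀))
    ⟨c, hc, hcU⟩ ⟨c', hc', hcU'⟩
  exact ⟨_, ⟨a₀, ha₀, b₀, hb₀, rfl⟩, h₀, h₀'⟩

theorem isIrreducible_tuples {D : ℕ} {V : Set (Fin D → ℂ)} (hV : IsIrreducible V)
    (κ : Type) [Finite κ] : IsIrreducible (tuples κ V) := by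
  induction κ using Finite.induction_empty_option with
  | of_equiv e h =>
    convert h.image (reindex e.symm) (continuous_reindex _).continuousOn
    ext z
    constructor
    · intro hz
      refine ⟨reindex e z, fun k => hz (e k), ?_⟩
      ext p
      simp [reindex]
    · rintro ⟨z, hz, rfl⟩ k
      exact hz (e.symm k)
  | h_empty =>
    have : tuples PEmpty V = {0} := by
      ext z
      simp only [tuples, IsEmpty.forall_iff, Set.ofPred_true, Set.mem_univ,
        Set.mem_singleton_iff, true_iff]
      exact Subsingleton.elim _ _
    rw [this]
    exact isIrreducible_singleton
  | h_option h =>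
    convert IsIrreducible.image2_of_separately_continuous continuous_optionPoint_left
      continuous_optionPoint_right h hV
    ext z
    constructor
    · intro hz
      refine ⟨reindex some z, fun k => hz (some k), fun j => z (none, j), hz none, ?_⟩
      ext ⟨_ | k, j⟩ <;> rfl
    · rintro ⟨x, hx, y, hy, rfl⟩ (_ | k)
      · exact hy
      · exact hx k

theorem reindex_surjOn {D : ℕ} {V : Set (Fin D → ℂ)} (hV : V.Nonempty) {κ l : Type*}
    {s : κ → l} (hs : Function.Injective s) {x : κ × Fin D → ℂ} (hx : x ∈ tuples κ V) :
    ∃ z ∈ tuples l V, reindex s z = x := by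
  classical
  obtain ⟨v, hv⟩ := hV
  refine ⟨fun p => Function.extend s (fun k j => x (k, j)) (fun _ => v) p.1 p.2, ?_, ?_⟩
  · intro k
    by_cases h : ∃ i, s i = k
    · obtain ⟨i, rfl⟩ := h
      simpa [hs.extend_apply] using hx i
    · simpa [Function.extend_apply' _ _ _ h] using hv
  · ext p
    simp [reindex, hs.extend_apply]

theorem IsIrreducible.inter_iInter_nonempty {X ι : Type*} [TopologicalSpace X] [Finite ι]
    {S : Set X} (hS : IsIrreducible S) {U : ι → Set X} (hU : ∀ i, IsOpen (U i))
    (hne : ∀ i, (S ∩ U i).Nonempty) : (S ∩ ⋂ i, U i).Nonempty := by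
  classical
  have := Fintype.ofFinite ι
  have h := isIrreducible_iff_sInter.1 hS (Finset.univ.image U) (by simpa using hU)
    (by simpa using hne)
  simpa using h

theorem IsIrreducible.isDenseOpenSubset {ι : Type*} {S U : Set (ι → ℂ)}
    (hS : IsIrreducible S) (hU : IsOpen U) (hne : (S ∩ U).Nonempty) :
    IsDenseOpenSubset (U ∩ S) S := by
  refine ⟨Set.inter_subset_right, ⟨U, hU, rfl⟩, fun x hx => ?_⟩
  refine mem_closure_iff.2 fun O hO hxO => ?_
  obtain ⟨z, hz, hzO, hzU⟩ := hS.2 O U hO hU ⟨x, hx, hxO⟩ hne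
  exact ⟨z, hzO, hzU, hz⟩

theorem IsDenseOpenSubset.nonempty {ι : Type*} {O S : Set (ι → ℂ)}
    (h : IsDenseOpenSubset O S) (hS : S.Nonempty) : O.Nonempty :=
  closure_nonempty_iff.1 (hS.mono h.2.2)

theorem comp_appendPoint_castSucc {m D : ℕ} (x : Fin m × Fin D → ℂ) (y : Fin D → ℂ)
    (i : Fin m) : comp (appendPoint x y) i.castSucc = fun j => x (i, j) := by
  ext j
  simp [comp, appendPoint]

theorem comp_appendPoint_last {m D : ℕ} (x : Fin m × Fin D → ℂ) (y : Fin D → ℂ) :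
    comp (appendPoint x y) (Fin.last m) = y := by
  ext j
  simp [comp, appendPoint]

theorem appendPoint_mem_prodSet {m D : ℕ} {V V' : Set (Fin D → ℂ)}
    {x : Fin m × Fin D → ℂ} {y : Fin D → ℂ} (hx : x ∈ tuples (Fin m) V) (hy : y ∈ V') :
    appendPoint x y ∈ prodSet m V V' := by
  constructor
  · intro i
    simpa only [comp_appendPoint_castSucc] using hx i
  · simpa only [comp_appendPoint_last] using hy

theorem exists_appendPoint_of_mem_prodSet {m D : ℕ} {V V' : Set (Fin D → ℂ)}
    {z : Fin (m + 1) × Fin D → ℂ} (hz : z ∈ prodSet m V V') :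
    ∃ x ∈ tuples (Fin m) V, ∃ y ∈ V', appendPoint x y = z := by
  refine ⟨reindex Fin.castSucc z, hz.1, comp z (Fin.last m), hz.2, ?_⟩
  ext ⟨i, j⟩
  induction i using Fin.lastCases <;> simp [appendPoint, reindex, comp]

theorem iSup_embTangent_appendPoint {m D : ℕ} (V : Set (Fin D → ℂ))
    (x : Fin m × Fin D → ℂ) (y : Fin D → ℂ) :
    ⨆ i : Fin m, embTangent V (comp (appendPoint x y) i.castSucc) = tangentSpan V x := by
  simp only [tangentSpan, comp_appendPoint_castSucc]

/-- The points over which a dense open subset of `V^m × V'` has a nonempty fibre form a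
nonempty open subset. -/
theorem IsDenseOpenSubset.exists_isOpen_fibre {m D : ℕ} {V V' : Set (Fin D → ℂ)}
    (hV : V.Nonempty) (hV' : V'.Nonempty) {W : Set (Fin (m + 1) × Fin D → ℂ)}
    (hW : IsDenseOpenSubset W (prodSet m V V')) :
    ∃ Y : Set (Fin D → ℂ), IsOpen Y ∧ (V' ∩ Y).Nonempty ∧ ∀ y ∈ V' ∩ Y,
      ∃ A : Set (Fin m × Fin D → ℂ), IsOpen A ∧ (tuples (Fin m) V ∩ A).Nonempty ∧
        ∀ x ∈ tuples (Fin m) V ∩ A, appendPoint x y ∈ W := by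
  obtain ⟨v, hv⟩ := hV
  obtain ⟨w, hw⟩ := hV'
  obtain ⟨z, hz⟩ := hW.nonempty
    ⟨_, appendPoint_mem_prodSet (x := fun p => v p.2) (fun _ => hv) hw⟩
  obtain ⟨-, ⟨U, hU, rfl⟩, -⟩ := hW
  refine ⟨⋃ x ∈ tuples (Fin m) V, appendPoint x ⁻¹' U,
    isOpen_biUnion fun x _ => IsOpen.preimage (continuous_appendPoint_right x) hU, ?_, ?_⟩
  · obtain ⟨x, hx, y, hy, rfl⟩ := exists_appendPoint_of_mem_prodSet hz.2
    exact ⟨y, hy, Set.mem_biUnion hx hz.1⟩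
  · rintro y ⟨hy, hyU⟩
    obtain ⟨x, hx, hxU⟩ := Set.mem_iUnion₂.1 hyU
    exact ⟨(fun x => appendPoint x y) ⁻¹' U,
      IsOpen.preimage (continuous_appendPoint_left y) hU, ⟨x, hx, hxU⟩,
      fun x' hx' => ⟨hx'.2, appendPoint_mem_prodSet hx'.1 hy⟩⟩

theorem mixedIndex_injective (m k : ℕ) : Function.Injective (mixedIndex m k) := by
  refine Function.LeftInverse.injective (g := Sum.elim id id) fun i => ?_
  unfold mixedIndex
  split_ifs <;> rfl

theorem snoc_mixedIndex_injective {m : ℕ} (k : Fin m) :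
    Function.Injective
      (Fin.snoc (α := fun _ => Fin m ⊕ Fin m) (mixedIndex m k) (Sum.inr k)) := by
  refine Fin.snoc_injective_iff.2 ⟨mixedIndex_injective m k, ?_⟩
  rintro ⟨i, hi⟩
  unfold mixedIndex at hi
  split_ifs at hi with h
  rw [Sum.inr.inj hi] at h
  exact lt_irrefl _ h

/-- Exchanging the subspaces of one family for those of another one at a time does not
change the intersection with `L`, if its dimension is the same for all the mixed families
involved and does not grow when one further subspace is added. -/
theorem iSup_inl_inf_eq_iSup_inr_inf {K E : Type*} [Field K] [AddCommGroup E] [Module K E]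
    [FiniteDimensional K E] {m : ℕ} (T : Fin m ⊕ Fin m → Submodule K E)
    (L : Submodule K E) (a : ℕ)
    (h : ∀ k : Fin (m + 1), Module.finrank K ↥((⨆ i, T (mixedIndex m k i)) ⊓ L) = a)
    (h' : ∀ k : Fin m, Module.finrank K ↥((⨆ i : Fin (m + 1),
      T (Fin.snoc (α := fun _ => Fin m ⊕ Fin m) (mixedIndex m k) (Sum.inr k) i)) ⊓ L) = a) :
    (⨆ i, T (Sum.inl i)) ⊓ L = (⨆ i, T (Sum.inr i)) ⊓ L := by
  have step : ∀ k : ℕ, k ≤ m →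
      (⨆ i, T (mixedIndex m 0 i)) ⊓ L = (⨆ i, T (mixedIndex m k i)) ⊓ L := by
    intro k
    induction k with
    | zero => intro _; rfl
    | succ k ih =>
      intro hk
      rw [ih (by omega)]
      let s : Fin (m + 1) → Fin m ⊕ Fin m :=
        Fin.snoc (α := fun _ => Fin m ⊕ Fin m) (mixedIndex m k) (Sum.inr ⟨k, hk⟩)
      have hs : Module.finrank K ↥((⨆ i, T (s i)) ⊓ L) = a := h' ⟨k, hk⟩
      have h₁ : (⨆ i, T (mixedIndex m k i)) ⊓ L = (⨆ i, T (s i)) ⊓ L := by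
        refine Submodule.eq_of_le_of_finrank_eq (inf_le_inf_right _ (iSup_le fun i => ?_))
          ((h ⟨k, by omega⟩).trans hs.symm)
        refine le_trans (le_of_eq ?_) (le_iSup _ i.castSucc)
        simp [s]
      have h₂ : (⨆ i, T (mixedIndex m (k + 1) i)) ⊓ L = (⨆ i, T (s i)) ⊓ L := by
        refine Submodule.eq_of_le_of_finrank_eq (inf_le_inf_right _ (iSup_le fun i => ?_))
          ((h ⟨k + 1, by omega⟩).trans hs.symm)
        rcases eq_or_ne i.val k with hik | hik
        · refine le_trans (le_of_eq ?_) (le_iSup _ (Fin.last m))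
          have : i = ⟨k, hk⟩ := Fin.ext hik
          simp [s, mixedIndex, this]
        · refine le_trans (le_of_eq ?_) (le_iSup _ i.castSucc)
          have : i.val < k + 1 ↔ i.val < k := by omega
          simp [s, mixedIndex, this]
      rw [h₁, h₂]
  have := step m le_rfl
  simpa [mixedIndex] using this

theorem sum_mul_eval_pderiv_bind₁ {D : ℕ} (e : (Fin D → ℂ) ≃ₗ[ℂ] (Fin D → ℂ))
    (v x : Fin D → ℂ) (f : MvPolynomial (Fin D) ℂ) :
    MvPolynomial.eval x (MvPolynomial.bind₁ (fun j => ∑ i, MvPolynomial.X i *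
        MvPolynomial.C (e (Pi.single i 1) j)) f) = MvPolynomial.eval (e x) f ∧
    ∑ i, v i * MvPolynomial.eval x (MvPolynomial.pderiv i (MvPolynomial.bind₁ (fun j =>
        ∑ i, MvPolynomial.X i * MvPolynomial.C (e (Pi.single i 1) j)) f)) =
      ∑ i, e v i * MvPolynomial.eval (e x) (MvPolynomial.pderiv i f) := by
  induction f using MvPolynomial.induction_on with
  | C a => simp
  | add p q hp hq =>
    simp only [map_add, mul_add, Finset.sum_add_distrib, hp, hq, and_self]
  | mul_X p n hp =>
    obtain ⟨hp, hp'⟩ := hp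
    have hX : ∀ w : Fin D → ℂ, ∑ i, w i * e (Pi.single i 1) n = e w n := fun w =>
      (linearEquiv_apply_eq_sum e w n).symm
    constructor
    · simp [hp, hX]
    · have h₁ : ∀ i, MvPolynomial.pderiv i (∑ k, MvPolynomial.X k *
          MvPolynomial.C (e (Pi.single k 1) n)) = MvPolynomial.C (e (Pi.single i 1) n) := by
        intro i
        simp [Derivation.leibniz, MvPolynomial.pderiv_X, Pi.single_apply]
      simp only [map_mul, MvPolynomial.bind₁_X_right, Derivation.leibniz, smul_eq_mul, map_add,
        h₁, MvPolynomial.eval_C, hp, mul_add, Finset.sum_add_distrib, MvPolynomial.eval_X,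
        map_sum, hX]
      have h₂ : ∀ (c : ℂ) (w u : Fin D → ℂ), ∑ i, w i * (c * u i) = c * ∑ i, w i * u i := by
        intro c w u
        rw [Finset.mul_sum]
        exact Finset.sum_congr rfl fun i _ => by ring
      simp only [h₂, hX, hp', MvPolynomial.pderiv_X]
      congr 2
      simp [Pi.single_apply, apply_ite]

theorem map_mem_embTangent {D : ℕ} {V : Set (Fin D → ℂ)}
    {e : (Fin D → ℂ) ≃ₗ[ℂ] (Fin D → ℂ)} (he : ∀ x ∈ V, e x ∈ V) {x v : Fin D → ℂ}
    (hv : v ∈ embTangent V x) : e v ∈ embTangent V (e x) := by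
  intro f hf
  rw [← (sum_mul_eval_pderiv_bind₁ e v x f).2]
  refine hv _ fun y hy => ?_
  rw [(sum_mul_eval_pderiv_bind₁ e v y f).1]
  exact hf _ (he y hy)

theorem map_mem_tangentSpan {D : ℕ} {κ : Type*} {V : Set (Fin D → ℂ)}
    {e : (Fin D → ℂ) ≃ₗ[ℂ] (Fin D → ℂ)} (he : ∀ x ∈ V, e x ∈ V) {z : κ × Fin D → ℂ}
    {v : Fin D → ℂ} (hv : v ∈ tangentSpan V z) :
    e v ∈ tangentSpan V (mapTuple e z) := by
  have h : tangentSpan V z ≤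
      (tangentSpan V (mapTuple e z)).comap (e : (Fin D → ℂ) →ₗ[ℂ] (Fin D → ℂ)) := by
    refine iSup_le fun k w hw => ?_
    rw [Submodule.mem_comap, LinearEquiv.coe_coe]
    have hle : embTangent V (e fun j => z (k, j)) ≤ tangentSpan V (mapTuple e z) :=
      le_iSup (fun k => embTangent V fun j => mapTuple e z (k, j)) k
    exact hle (map_mem_embTangent he hw)
  have hv' := h hv
  rwa [Submodule.mem_comap, LinearEquiv.coe_coe] at hv'

/-- The vectors lying in the tangent span of a general tuple. -/
def genericTangentSpan {D : ℕ} {V : Set (Fin D → ℂ)} (hV : IsIrreducible V) (m : ℕ) :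
    Submodule ℂ (Fin D → ℂ) where
  carrier := { v | ∃ U : Set (Fin m × Fin D → ℂ), IsOpen U ∧
    (tuples (Fin m) V ∩ U).Nonempty ∧ ∀ x ∈ tuples (Fin m) V ∩ U, v ∈ tangentSpan V x }
  add_mem' := by
    rintro v w ⟨A, hA, hA', hvA⟩ ⟨B, hB, hB', hwB⟩
    exact ⟨A ∩ B, hA.inter hB, (isIrreducible_tuples hV (Fin m)).2 A B hA hB hA' hB',
      fun x hx => add_mem (hvA x ⟨hx.1, hx.2.1⟩) (hwB x ⟨hx.1, hx.2.2⟩)⟩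
  zero_mem' := ⟨Set.univ, isOpen_univ, by
    simpa using (isIrreducible_tuples hV (Fin m)).1, fun _ _ => zero_mem _⟩
  smul_mem' := by
    rintro c v ⟨A, hA, hA', hvA⟩
    exact ⟨A, hA, hA', fun x hx => Submodule.smul_mem _ c (hvA x hx)⟩

theorem map_mem_genericTangentSpan {D m : ℕ} {V : Set (Fin D → ℂ)} (hV : IsIrreducible V)
    {e : (Fin D → ℂ) ≃ₗ[ℂ] (Fin D → ℂ)} (he : ∀ x ∈ V, e x ∈ V)
    (he' : ∀ x ∈ V, e.symm x ∈ V) {v : Fin D → ℂ} (hv : v ∈ genericTangentSpan hV m) :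
    e v ∈ genericTangentSpan hV m := by
  obtain ⟨U, hU, ⟨x, hx, hxU⟩, hvU⟩ := hv
  have hsymm : ∀ (e : (Fin D → ℂ) ≃ₗ[ℂ] (Fin D → ℂ)) (z : Fin m × Fin D → ℂ),
      mapTuple e.symm (mapTuple e z) = z := by
    intro e z
    ext p
    change e.symm (e fun j => z (p.1, j)) p.2 = _
    simp
  refine ⟨mapTuple e.symm ⁻¹' U, hU.preimage (continuous_mapTuple _),
    ⟨mapTuple e x, fun k => he _ (hx k), by simpa [hsymm] using hxU⟩, fun z hz => ?_⟩
  have h := map_mem_tangentSpan he (hvU (mapTuple e.symm z) ⟨fun k => he' _ (hz.1 k), hz.2⟩)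
  have hz' : mapTuple e (mapTuple e.symm z) = z := hsymm e.symm z
  rwa [hz'] at h

theorem exists_isOpen_tangentSpan_eq_top {D m : ℕ} {V : Set (Fin D → ℂ)}
    (hV : IsIrreducible V) (htop : genericTangentSpan hV m = ⊤) :
    ∃ U : Set (Fin m × Fin D → ℂ), IsOpen U ∧ (tuples (Fin m) V ∩ U).Nonempty ∧
      ∀ x ∈ tuples (Fin m) V ∩ U, tangentSpan V x = ⊤ := by
  have h : ∀ i : Fin D, Pi.single i (1 : ℂ) ∈ genericTangentSpan hV m := fun i =>
    htop ▸ Submodule.mem_top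
  choose U hU hne hmem using h
  refine ⟨⋂ i, U i, isOpen_iInter_of_finite hU,
    (isIrreducible_tuples hV (Fin m)).inter_iInter_nonempty hU hne, fun x hx => ?_⟩
  rw [eq_top_iff, ← (Pi.basisFun ℂ (Fin D)).span_eq, Submodule.span_le]
  rintro _ ⟨i, rfl⟩
  rw [Pi.basisFun_apply]
  exact hmem i x ⟨hx.1, Set.mem_iInter.1 hx.2 i⟩

/-- If the intersection of the tangent span with `L` has the same dimension `a ≠ 0` for
general `m`-tuples and general `(m + 1)`-tuples, some nonzero vector lies in the tangent
span of a general `m`-tuple. -/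
theorem genericTangentSpan_ne_bot {D m a : ℕ} {V : Set (Fin D → ℂ)} (hV : IsIrreducible V)
    (L : Submodule ℂ (Fin D → ℂ)) (ha : a ≠ 0)
    {A : Set (Fin m × Fin D → ℂ)} (hA : IsOpen A) (hAne : (tuples (Fin m) V ∩ A).Nonempty)
    (hAa : ∀ x ∈ tuples (Fin m) V ∩ A, Module.finrank ℂ ↥(tangentSpan V x ⊓ L) = a)
    {B : Set (Fin (m + 1) × Fin D → ℂ)} (hB : IsOpen B)
    (hBne : (tuples (Fin (m + 1)) V ∩ B).Nonempty)
    (hBa : ∀ x ∈ tuples (Fin (m + 1)) V ∩ B,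
      Module.finrank ℂ ↥(tangentSpan V x ⊓ L) = a) :
    genericTangentSpan hV m ≠ ⊥ := by
  let s : Fin m → Fin (m + 1) → Fin m ⊕ Fin m := fun k =>
    Fin.snoc (α := fun _ => Fin m ⊕ Fin m) (mixedIndex m k) (Sum.inr k)
  let U : Fin (m + 1) ⊕ Fin m → Set ((Fin m ⊕ Fin m) × Fin D → ℂ) :=
    Sum.elim (fun k => reindex (mixedIndex m k) ⁻¹' A) (fun k => reindex (s k) ⁻¹' B)
  have hU : ∀ i, IsOpen (U i) := by
    rintro (k | k)
    · exact hA.preimage (continuous_reindex _)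
    · exact hB.preimage (continuous_reindex _)
  have hUne : ∀ i, (tuples (Fin m ⊕ Fin m) V ∩ U i).Nonempty := by
    rintro (k | k)
    · obtain ⟨x, hx, hxA⟩ := hAne
      obtain ⟨z, hz, rfl⟩ := reindex_surjOn hV.1 (mixedIndex_injective m k) hx
      exact ⟨z, hz, hxA⟩
    · obtain ⟨x, hx, hxB⟩ := hBne
      obtain ⟨z, hz, rfl⟩ := reindex_surjOn hV.1 (snoc_mixedIndex_injective k) hx
      exact ⟨z, hz, hxB⟩
  have hexch : ∀ z ∈ tuples (Fin m ⊕ Fin m) V ∩ ⋂ i, U i,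
      tangentSpan V (reindex Sum.inl z) ⊓ L = tangentSpan V (reindex Sum.inr z) ⊓ L := by
    rintro z ⟨hz, hzU⟩
    rw [Set.mem_iInter] at hzU
    exact iSup_inl_inf_eq_iSup_inr_inf (fun k => embTangent V fun j => z (k, j)) L a
      (fun k => hAa (reindex (mixedIndex m k) z) ⟨fun i => hz (mixedIndex m k i), hzU (Sum.inl k)⟩)
      (fun k => hBa (reindex (s k) z) ⟨fun i => hz (s k i), hzU (Sum.inr k)⟩)
  obtain ⟨z, hz, hzU⟩ :=
    (isIrreducible_tuples hV (Fin m ⊕ Fin m)).inter_iInter_nonempty hU hUne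
  have hzinl : reindex Sum.inl z ∈ tuples (Fin m) V ∩ A := by
    refine ⟨fun i => hz (Sum.inl i), ?_⟩
    have h0 : reindex (mixedIndex m 0) z ∈ A := Set.mem_iInter.1 hzU (Sum.inl 0)
    have hinl : mixedIndex m 0 = Sum.inl := by
      ext i
      simp [mixedIndex]
    rwa [hinl] at h0
  obtain ⟨v, hv, hv0⟩ : ∃ v ∈ tangentSpan V (reindex Sum.inl z) ⊓ L, v ≠ 0 := by
    refine Submodule.exists_mem_ne_zero_of_ne_bot fun hbot => ha ?_
    rw [← hAa _ hzinl, hbot, finrank_bot]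
  refine (Submodule.ne_bot_iff _).2 ⟨v, ⟨concat (reindex Sum.inl z) ⁻¹' ⋂ i, U i,
    (isOpen_iInter_of_finite hU).preimage (continuous_concat_right _),
    ⟨reindex Sum.inr z, fun i => hz (Sum.inr i), ?_⟩, ?_⟩, hv0⟩
  · have : concat (reindex Sum.inl z) (reindex Sum.inr z) = z := by
      ext ⟨_ | k, j⟩ <;> rfl
    simpa only [Set.mem_preimage, this] using hzU
  · rintro x ⟨hx, hxU⟩
    have h := hexch (concat (reindex Sum.inl z) x) ⟨by
      rintro (k | k)
      · exact hz (Sum.inl k)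
      · exact hx k, hxU⟩
    have hv' : v ∈ tangentSpan V (reindex Sum.inr (concat (reindex Sum.inl z) x)) ⊓ L :=
      h ▸ hv
    exact hv'.1

end Zariski

theorem stmt_2 {D : ℕ} {G : Type*} [Group G]
    (ρ : G →* ((Fin D → ℂ) ≃ₗ[ℂ] (Fin D → ℂ)))
    (hmod : IsIrreducibleGModule ρ)
    (V V' : Set (Fin D → ℂ))
    (hVclosed : zIsClosed V) (hVirr : zIsIrreducible V)
    (hVcone : ∀ (c : ℂ), ∀ x ∈ V, c • x ∈ V)
    (hVinv : ∀ (g : G), ∀ x ∈ V, ρ g x ∈ V)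
    (hV0 : V ≠ {0})
    (hV'closed : zIsClosed V') (hV'irr : zIsIrreducible V')
    (hV'cone : ∀ (c : ℂ), ∀ y ∈ V', c • y ∈ V')
    (hV'inv : ∀ (g : G), ∀ y ∈ V', ρ g y ∈ V')
    (hV'0 : V' ≠ {0})
    (O O' : Set (Fin D → ℂ))
    (hO : IsDenseOpenSubset O V) (hO' : IsDenseOpenSubset O' V')
    (N N' : ℕ)
    (hN : ∀ x ∈ O, Module.finrank ℂ (embTangent V x) = N)
    (hN' : ∀ y ∈ O', Module.finrank ℂ (embTangent V' y) = N')
    (m : ℕ) (hm : 1 ≤ m) (a a' : ℕ)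
    (W : Set (Fin (m + 1) × Fin D → ℂ))
    (hW : IsDenseOpenSubset W (prodSet m V V'))
    (hWcond : ∀ z ∈ W, (∀ i : Fin m, comp z i.castSucc ∈ O) ∧
      comp z (Fin.last m) ∈ O' ∧
      Module.finrank ℂ
        ↥((⨆ i : Fin m, embTangent V (comp z i.castSucc)) ⊓
            embTangent V' (comp z (Fin.last m))) = a)
    (W' : Set (Fin (m + 2) × Fin D → ℂ))
    (hW' : IsDenseOpenSubset W' (prodSet (m + 1) V V'))
    (hW'cond : ∀ z ∈ W', (∀ i : Fin (m + 1), comp z i.castSucc ∈ O) ∧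
      comp z (Fin.last (m + 1)) ∈ O' ∧
      Module.finrank ℂ
        ↥((⨆ i : Fin (m + 1), embTangent V (comp z i.castSucc)) ⊓
            embTangent V' (comp z (Fin.last (m + 1)))) = a')
    (haa' : a' = a) (ha : a ≠ 0) :
    a = N' ∧
    ∃ Ω : Set (Fin m × Fin D → ℂ), IsDenseOpenSubset Ω (powSet m V) ∧
      ∀ z ∈ Ω, (⨆ i : Fin m, embTangent V (comp z i)) = ⊤ := by
  obtain ⟨Y, hY, hYne, hYW⟩ := hW.exists_isOpen_fibre hVirr.1 hV'irr.1
  obtain ⟨Y', hY', hYne', hYW'⟩ := hW'.exists_isOpen_fibre hVirr.1 hV'irr.1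
  obtain ⟨y, hy, hyY, hyY'⟩ := hV'irr.2 Y Y' hY hY' hYne hYne'
  obtain ⟨A, hA, hAne, hAW⟩ := hYW y ⟨hy, hyY⟩
  obtain ⟨B, hB, hBne, hBW⟩ := hYW' y ⟨hy, hyY'⟩
  have hAa : ∀ x ∈ tuples (Fin m) V ∩ A,
      Module.finrank ℂ ↥(tangentSpan V x ⊓ embTangent V' y) = a := fun x hx => by
    have h := (hWcond _ (hAW x hx)).2.2
    rwa [iSup_embTangent_appendPoint, comp_appendPoint_last] at h
  have hBa : ∀ x ∈ tuples (Fin (m + 1)) V ∩ B,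
      Module.finrank ℂ ↥(tangentSpan V x ⊓ embTangent V' y) = a := fun x hx => by
    have h := (hW'cond _ (hBW x hx)).2.2
    rwa [iSup_embTangent_appendPoint, comp_appendPoint_last, haa'] at h
  have htop : genericTangentSpan hVirr m = ⊤ := by
    refine (hmod.2 _ fun g x hx => ?_).resolve_left
      (genericTangentSpan_ne_bot hVirr _ ha hA hAne hAa hB hBne hBa)
    refine map_mem_genericTangentSpan hVirr (hVinv g) (fun x hx => ?_) hx
    have h := hVinv g⁻¹ x hx
    rwa [map_inv] at h
  obtain ⟨U, hU, hUne, hUtop⟩ := exists_isOpen_tangentSpan_eq_top hVirr htop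
  have hirr := isIrreducible_tuples hVirr (Fin m)
  refine ⟨?_, U ∩ tuples (Fin m) V, hirr.isDenseOpenSubset hU hUne,
    fun z hz => hUtop z ⟨hz.2, hz.1⟩⟩
  obtain ⟨x, hx, hxA, hxU⟩ := hirr.2 A U hA hU hAne hUne
  have hyO' := (hWcond _ (hAW x ⟨hx, hxA⟩)).2.1
  rw [comp_appendPoint_last] at hyO'
  rw [← hAa x ⟨hx, hxA⟩, hUtop x ⟨hx, hxU⟩, top_inf_eq, hN' y hyO']
end
end

section
/- (Stationarity Lemma, ideal version.) Let n ≥ 1, d ≥ 1, k ≥ 1 and m ≥ 1. Let V ⊆ S^d_n be an irreducible Zariski-closed cone with V ≠ {0} which is invariant under the substitution action of GL_n(ℂ) (for every invertible linear change of variables g and every f ∈ V, f ∘ g ∈ V). For x ∈ S^d_n let x·S^k := {x * h : h ∈ S^k_n}, a ℂ-subspace of S^{d+k}_n. Let a, a' : ℕ and suppose there are dense open subsets W ⊆ V^m × V and W' ⊆ V^{m+1} × V such that finrank ((x₁·S^k ⊔ ⋯ ⊔ x_m·S^k) ⊓ y·S^k) = a for all ((x₁,…,x_m), y) ∈ W,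 and finrank ((x₁·S^k ⊔ ⋯ ⊔ x_{m+1}·S^k) ⊓ y·S^k) = a' for all ((x₁,…,x_{m+1}), y) ∈ W'. If a' = a and a ≠ 0, then a = choose (n+k−1) k and there is a dense open subset of V^m on every point (x₁,…,x_m) of which x₁·S^k ⊔ ⋯ ⊔ x_m·S^k = S^{d+k}_n. -/
/-!
STATEMENT 3: the Stationarity Lemma, ideal version.
-/

noncomputable section

open MvPolynomial

/-- The Zariski topology on a `ℂ`-vector space `M` (for finite-dimensional `M`,
identified with a coordinate space via a basis, this is the topology in which a set
is closed iff it is the common zero locus of a family of polynomial functions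
of the coordinates). -/
def ztV (M : Type*) [AddCommGroup M] [Module ℂ M] : TopologicalSpace M :=
  TopologicalSpace.generateFrom
    { U | ∃ (k : ℕ) (p : MvPolynomial (Fin k) ℂ) (L : Fin k → M →ₗ[ℂ] ℂ),
        U = { x | MvPolynomial.eval (fun i => L i x) p ≠ 0 } }

def zIsClosedV {M : Type*} [AddCommGroup M] [Module ℂ M] (S : Set M) : Prop :=
  @IsClosed _ (ztV M) S

def zIsOpenV {M : Type*} [AddCommGroup M] [Module ℂ M] (S : Set M) : Prop :=
  @IsOpen _ (ztV M) S

def zIsIrreducibleV {M : Type*} [AddCommGroup M] [Module ℂ M] (S : Set M) : Prop :=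
  @IsIrreducible _ (ztV M) S

def zClosureV {M : Type*} [AddCommGroup M] [Module ℂ M] (S : Set M) : Set M :=
  @closure _ (ztV M) S

/-- `O` is a dense open subset of `S` (for the subspace topology on `S`). -/
def IsDenseOpenSubsetV {M : Type*} [AddCommGroup M] [Module ℂ M] (O S : Set M) : Prop :=
  O ⊆ S ∧ (∃ U, zIsOpenV U ∧ O = U ∩ S) ∧ S ⊆ zClosureV O

/-- The substitution action of an invertible matrix `g` on polynomials: `g · f = f ∘ g`,
i.e. `X i ↦ ∑ j, g i j • X j`. -/
def substAction {n : ℕ} (g : GL (Fin n) ℂ) (f : MvPolynomial (Fin n) ℂ) :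
    MvPolynomial (Fin n) ℂ :=
  MvPolynomial.aeval
    (fun i => ∑ j, ((g : Matrix (Fin n) (Fin n) ℂ) i j) • (MvPolynomial.X j)) f

/-- For `x ∈ S^d_n`, the subspace `x·S^k = {x * h : h ∈ S^k_n}` of `S^{d+k}_n`. -/
def mulSpace (n d k : ℕ) (x : MvPolynomial (Fin n) ℂ) :
    Submodule ℂ ↥(homogeneousSubmodule (Fin n) ℂ (d + k)) :=
  Submodule.comap (homogeneousSubmodule (Fin n) ℂ (d + k)).subtype
    ((homogeneousSubmodule (Fin n) ℂ k).map (LinearMap.mulLeft ℂ x))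

section Substitution

/-- Substitution of linear forms `X i ↦ ∑ j, A i j • X j` for an arbitrary square matrix `A`. -/
def linSubst {n : ℕ} (A : Matrix (Fin n) (Fin n) ℂ) :
    MvPolynomial (Fin n) ℂ →ₐ[ℂ] MvPolynomial (Fin n) ℂ :=
  aeval fun i => ∑ j, A i j • X j

theorem linSubst_isHomogeneous {n e : ℕ} (A : Matrix (Fin n) (Fin n) ℂ)
    {f : MvPolynomial (Fin n) ℂ} (hf : f.IsHomogeneous e) : (linSubst A f).IsHomogeneous e := by
  have h := hf.aeval (n := 1) (fun i => ∑ j, A i j • (X j : MvPolynomial (Fin n) ℂ)) fun i =>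
    IsHomogeneous.sum _ _ _ fun j _ => by
      rw [smul_eq_C_mul]
      exact (isHomogeneous_X ℂ j).C_mul _
  rwa [one_mul] at h

theorem linSubst_one {n : ℕ} (f : MvPolynomial (Fin n) ℂ) : linSubst 1 f = f := by
  have : linSubst (1 : Matrix (Fin n) (Fin n) ℂ) = AlgHom.id ℂ _ := by
    ext i : 1
    simp [linSubst, Matrix.one_apply]
  simp [this]

theorem linSubst_linSubst {n : ℕ} (A B : Matrix (Fin n) (Fin n) ℂ) (f : MvPolynomial (Fin n) ℂ) :
    linSubst A (linSubst B f) = linSubst (B * A) f := by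
  have : (linSubst A).comp (linSubst B) = linSubst (B * A) := by
    ext i : 1
    simp only [linSubst, AlgHom.comp_apply, aeval_X, map_sum, map_smul, Matrix.mul_apply,
      Finset.smul_sum, Finset.sum_smul, smul_smul]
    exact Finset.sum_comm
  exact DFunLike.congr_fun this f

/-- A subspace containing the values of a vector-valued polynomial at infinitely many scalars
contains its constant coefficient. -/
theorem coeff_zero_mem_of_infinite {A : Type*} [CommRing A] [Algebra ℂ A] (U : Submodule ℂ A)
    (F : Polynomial A) {s : Set ℂ} (hs : s.Infinite)
    (h : ∀ t ∈ s, F.eval (algebraMap ℂ A t) ∈ U) : F.coeff 0 ∈ U := by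
  by_contra hF
  obtain ⟨φ, hφ, hU⟩ := Submodule.exists_le_ker_of_notMem hF
  let q : Polynomial ℂ := ∑ j ∈ F.support, Polynomial.monomial j (φ (F.coeff j))
  have hq : q = 0 := by
    refine Polynomial.eq_zero_of_infinite_isRoot q (hs.mono fun t ht => ?_)
    have h0 : φ (F.eval (algebraMap ℂ A t)) = 0 := hU (h t ht)
    rw [Polynomial.eval_eq_sum, Polynomial.sum_def, map_sum] at h0
    rw [Set.mem_ofPred_eq, Polynomial.IsRoot.def, Polynomial.eval_finsetSum, ← h0]
    refine Finset.sum_congr rfl fun j _ => ?_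
    rw [Polynomial.eval_monomial, ← map_pow, mul_comm (F.coeff j), ← Algebra.smul_def, map_smul,
      smul_eq_mul, mul_comm]
  have h1 : q.coeff 0 = φ (F.coeff 0) := by
    simp only [q, Polynomial.finsetSum_coeff, Polynomial.coeff_monomial]
    rw [Finset.sum_ite_eq']
    split_ifs with h2
    · rfl
    · rw [Polynomial.notMem_support_iff.mp h2, map_zero]
  exact hφ (by rw [← h1, hq, Polynomial.coeff_zero])

/-- A `GL`-stable subspace is stable under all linear substitutions, also the singular ones. -/
theorem linSubst_mem_of_substAction_mem {n : ℕ} (U : Submodule ℂ (MvPolynomial (Fin n) ℂ))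
    (hU : ∀ (g : GL (Fin n) ℂ), ∀ f ∈ U, substAction g f ∈ U) (A : Matrix (Fin n) (Fin n) ℂ)
    {f : MvPolynomial (Fin n) ℂ} (hf : f ∈ U) : linSubst A f ∈ U := by
  let F : Polynomial (MvPolynomial (Fin n) ℂ) :=
    aeval (fun i => Polynomial.C (∑ j, A i j • X j) + Polynomial.X * Polynomial.C (X i)) f
  have hF0 : F.coeff 0 = linSubst A f := by
    rw [Polynomial.coeff_zero_eq_eval_zero, ← Polynomial.coe_evalRingHom]
    simp only [F, aeval_def, linSubst, hom_eval₂]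
    congr 1
    · ext; simp
    · ext i : 1
      simp [Polynomial.eval_finsetSum]
  rw [← hF0]
  have hfin : ((-A).charpoly.roots.toFinset : Set ℂ).Finite := Finset.finite_toSet _
  refine coeff_zero_mem_of_infinite U F hfin.infinite_compl fun t ht => ?_
  have hdet : (Matrix.scalar (Fin n) t + A).det ≠ 0 := fun h0 => ht <| by
    simp only [Finset.mem_coe, Multiset.mem_toFinset]
    rw [Polynomial.mem_roots (-A).charpoly_monic.ne_zero, Polynomial.IsRoot.def,
      Matrix.eval_charpoly, sub_neg_eq_add, h0]
  convert hU (Matrix.GeneralLinearGroup.mkOfDetNeZero _ hdet) f hf using 1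
  rw [← Polynomial.coe_evalRingHom]
  simp only [F, aeval_def, substAction, hom_eval₂]
  congr 1
  · ext; simp
  · ext i : 1
    simp [Matrix.GeneralLinearGroup.mkOfDetNeZero, Matrix.diagonal_apply, add_smul,
      Finset.sum_add_distrib, smul_eq_C_mul, Polynomial.eval_finsetSum]
    ring

/-- A subspace containing the `e`-th powers of all linear forms contains all forms of
degree `e`. -/
theorem homogeneousSubmodule_le_of_pow_mem {n e : ℕ} (U : Submodule ℂ (MvPolynomial (Fin n) ℂ))
    (hU : ∀ c : Fin n → ℂ, (∑ j, c j • X j) ^ e ∈ U) :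
    homogeneousSubmodule (Fin n) ℂ e ≤ U := by
  have key : ∀ s : Fin n →₀ ℕ, s.degree = e → monomial s (1 : ℂ) ∈ U := by
    intro s hs
    by_contra hsU
    obtain ⟨φ, hφ, hφU⟩ := Submodule.exists_le_ker_of_notMem hsU
    let P : MvPolynomial (Fin n) ℂ := ∑ k ∈ Finset.piAntidiag Finset.univ e,
      monomial (Finsupp.equivFunOnFinite.symm k)
        ((Nat.multinomial Finset.univ k : ℂ) *
          φ (monomial (Finsupp.equivFunOnFinite.symm k) 1))
    have hmon : ∀ k : Fin n → ℕ, (∏ i, X i ^ k i : MvPolynomial (Fin n) ℂ) =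
        monomial (Finsupp.equivFunOnFinite.symm k) 1 := by
      intro k
      rw [monomial_eq, C_1, one_mul, Finsupp.prod_fintype _ _ fun i => pow_zero _]
      rfl
    have hP : P = 0 := by
      refine funext fun c => ?_
      have h0 : φ ((∑ j, c j • X j) ^ e) = 0 := hφU (hU c)
      rw [Finset.sum_pow_eq_sum_piAntidiag, map_sum] at h0
      rw [map_zero, ← h0, map_sum]
      refine Finset.sum_congr rfl fun k _ => ?_
      simp only [smul_pow, Finset.prod_smul, hmon]
      rw [← nsmul_eq_mul (_ : ℕ) (_ : MvPolynomial (Fin n) ℂ), map_nsmul φ, map_smul, eval_monomial,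
        Finsupp.prod_fintype _ _ fun i => pow_zero _]
      simp only [Finsupp.equivFunOnFinite_symm_apply_apply, nsmul_eq_mul, smul_eq_mul]
      ring
    have hc : P.coeff s = (Nat.multinomial Finset.univ s : ℂ) * φ (monomial s 1) := by
      simp only [P, coeff_sum, coeff_monomial]
      rw [Finset.sum_eq_single (s : Fin n → ℕ)]
      · simp
      · intro k _ hk
        rw [if_neg]
        rintro rfl
        exact hk (by simp)
      · intro h
        exact absurd (by simpa [Finset.mem_piAntidiag, Finsupp.degree_eq_sum] using hs) h
    rw [hP, coeff_zero, eq_comm, mul_eq_zero] at hc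
    exact hc.elim (fun h => (Nat.multinomial_pos _ _).ne' (by exact_mod_cast h)) hφ
  intro f hf
  rw [← f.support_sum_monomial_coeff]
  refine U.sum_mem fun s hs => ?_
  rw [← mul_one (f.coeff s), ← smul_eq_mul, ← smul_monomial]
  refine U.smul_mem _ (key s ?_)
  rw [Finsupp.degree_eq_weight_one]
  exact hf (mem_support_iff.mp hs)

/-- The space of forms of degree `e` is an irreducible representation of `GL`. -/
theorem homogeneousSubmodule_le_of_substAction_mem {n e : ℕ}
    (U : Submodule ℂ (MvPolynomial (Fin n) ℂ))
    (hU : ∀ (g : GL (Fin n) ℂ), ∀ f ∈ U, substAction g f ∈ U)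
    {f : MvPolynomial (Fin n) ℂ} (hf : f ∈ U) (hfe : f.IsHomogeneous e) (hf0 : f ≠ 0) :
    homogeneousSubmodule (Fin n) ℂ e ≤ U := by
  obtain ⟨p, hp⟩ : ∃ p, eval p f ≠ 0 := by
    by_contra! h
    exact hf0 (funext fun p => by rw [h, map_zero])
  refine homogeneousSubmodule_le_of_pow_mem U fun c => ?_
  have h := linSubst_mem_of_substAction_mem U hU (Matrix.vecMulVec p c) hf
  have h1 : linSubst (Matrix.vecMulVec p c) f = eval p f • (∑ j, c j • X j) ^ e := by
    have h2 : ∀ i, ∑ j, Matrix.vecMulVec p c i j • (X j : MvPolynomial (Fin n) ℂ) =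
        (∑ j, c j • X j) * C (p i) := fun i => by
      simp only [Matrix.vecMulVec_apply, mul_smul, ← Finset.smul_sum]
      rw [smul_eq_C_mul, mul_comm]
    simp only [linSubst, h2]
    rw [aeval_def, eval₂_eq, eval_eq, Finset.sum_smul]
    refine Finset.sum_congr rfl fun s hs => ?_
    have hs : ∑ i, s i = e := by
      rw [← Finsupp.degree_eq_sum, Finsupp.degree_eq_weight_one]
      exact hfe (mem_support_iff.mp hs)
    have h3 : ∏ i ∈ s.support, ((∑ j, c j • (X j : MvPolynomial (Fin n) ℂ)) * C (p i)) ^ s i =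
        (∑ j, c j • X j) ^ e * C (∏ i ∈ s.support, p i ^ s i) := by
      simp only [mul_pow, Finset.prod_mul_distrib, Finset.prod_pow_eq_pow_sum, map_prod, map_pow]
      congr 2
      rw [← hs]
      exact Finset.sum_subset (Finset.subset_univ _) fun i _ hi => Finsupp.notMem_support_iff.mp hi
    rw [h3, smul_eq_C_mul, C_mul, algebraMap_eq]
    ring
  rw [h1] at h
  exact (U.smul_mem_iff hp).mp h

theorem finrank_homogeneousSubmodule (n k : ℕ) :
    Module.finrank ℂ (homogeneousSubmodule (Fin n) ℂ k) = Nat.choose (n + k - 1) k := by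
  rw [homogeneousSubmodule_eq_finsupp_supported]
  change Module.finrank ℂ (restrictSupport ℂ {s : Fin n →₀ ℕ | s.degree = k}) = _
  rw [Module.finrank_eq_nat_card_basis (basisRestrictSupport ℂ {s : Fin n →₀ ℕ | s.degree = k})]
  have : {s : Fin n →₀ ℕ | s.degree = k} =
      (Finset.univ.finsuppAntidiag k : Finset (Fin n →₀ ℕ)) := by
    ext s
    simp [Finset.mem_finsuppAntidiag, Finsupp.degree_eq_sum]
  rw [this, Nat.card_coe_set_eq, Set.ncard_coe_finset,
    Finset.card_finsuppAntidiag_nat_eq_choose, Finset.card_univ, Fintype.card_fin]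

instance finite_homogeneousSubmodule (n k : ℕ) :
    Module.Finite ℂ (homogeneousSubmodule (Fin n) ℂ k) :=
  Module.Finite.iff_fg.mpr (homogeneousSubmodule_fg (Fin n) ℂ k)

theorem mem_mulSpace {n d k : ℕ} {x : MvPolynomial (Fin n) ℂ}
    {f : homogeneousSubmodule (Fin n) ℂ (d + k)} :
    f ∈ mulSpace n d k x ↔ ∃ h, h.IsHomogeneous k ∧ x * h = f := by
  simp [mulSpace, Submodule.mem_map]

theorem finrank_mulSpace {n d k : ℕ} {x : MvPolynomial (Fin n) ℂ} (hx : x.IsHomogeneous d)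
    (hx0 : x ≠ 0) : Module.finrank ℂ (mulSpace n d k x) = Nat.choose (n + k - 1) k := by
  have hle : (homogeneousSubmodule (Fin n) ℂ k).map (LinearMap.mulLeft ℂ x) ≤
      homogeneousSubmodule (Fin n) ℂ (d + k) := by
    rintro _ ⟨h, hh, rfl⟩
    exact hx.mul hh
  rw [mulSpace, (Submodule.comapSubtypeEquivOfLe hle).finrank_eq, ← finrank_homogeneousSubmodule]
  exact (LinearEquiv.finrank_eq (Submodule.equivMapOfInjective _
    (mul_right_injective₀ hx0) _)).symm

end Substitution

section Generic

variable {M N : Type*} [AddCommGroup M] [Module ℂ M] [AddCommGroup N] [Module ℂ N]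

theorem zIsOpenV.inter {U U' : Set M} (hU : zIsOpenV U) (hU' : zIsOpenV U') :
    zIsOpenV (U ∩ U') :=
  @IsOpen.inter M (ztV M) _ _ ‹_› ‹_›

/-- Affine maps are continuous for the Zariski topology. -/
theorem zIsOpenV.preimage_affine {U : Set N} (hU : zIsOpenV U) (A : M →ₗ[ℂ] N) (b : N) :
    zIsOpenV {x | A x + b ∈ U} := by
  have hcont : @Continuous M N (ztV M) (ztV N) fun x => A x + b := by
    refine continuous_generateFrom_iff.mpr ?_
    rintro _ ⟨k, p, L, rfl⟩
    refine TopologicalSpace.isOpen_generateFrom_of_mem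
      ⟨k, bind₁ (fun i => X i + C (L i b)) p, fun i => (L i).comp A, ?_⟩
    ext x
    simp only [Set.mem_preimage, Set.mem_ofPred_eq, ← aeval_eq_eval, aeval_bind₁]
    simp
  exact @IsOpen.preimage M N (ztV M) (ztV N) _ hcont _ hU

theorem zIsOpenV.preimage_linear {U : Set N} (hU : zIsOpenV U) (A : M →ₗ[ℂ] N) :
    zIsOpenV {x | A x ∈ U} := by
  simpa using hU.preimage_affine A 0

/-- Two open sets meeting an irreducible set meet it in a common point. -/
theorem zIsIrreducibleV.exists_mem {V : Set M} (hV : zIsIrreducibleV V) {U U' : Set M}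
    (hU : zIsOpenV U) (hU' : zIsOpenV U') (h : ∃ x ∈ V, x ∈ U) (h' : ∃ x ∈ V, x ∈ U') :
    ∃ x ∈ V, x ∈ U ∧ x ∈ U' :=
  hV.2 _ _ hU hU' h ‹_›

/-- A power of an irreducible set is irreducible. -/
theorem zIsIrreducibleV.exists_mem_pi {V : Set M} (hV : zIsIrreducibleV V) {ι : Type*} [Finite ι]
    {U U' : Set (ι → M)} (hU : zIsOpenV U) (hU' : zIsOpenV U')
    (h : ∃ z ∈ U, ∀ i, z i ∈ V) (h' : ∃ z ∈ U', ∀ i, z i ∈ V) :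
    ∃ z ∈ U ∩ U', ∀ i, z i ∈ V := by
  classical
  cases nonempty_fintype ι
  have key : ∀ s : Finset ι, ∃ z ∈ U, ∃ z' ∈ U',
      (∀ i, z i ∈ V) ∧ (∀ i, z' i ∈ V) ∧ ∀ i ∈ s, z i = z' i := by
    intro s
    induction s using Finset.induction_on with
    | empty =>
      obtain ⟨z, hz, hzV⟩ := h
      obtain ⟨z', hz', hzV'⟩ := h'
      exact ⟨z, hz, z', hz', hzV, hzV', by simp⟩
    | insert j s _ ih =>
      obtain ⟨z, hz, z', hz', hzV, hzV', hs⟩ := ih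
      have hupd : ∀ (w : ι → M) (v : M),
          LinearMap.single ℂ (fun _ : ι => M) j v + Function.update w j 0 =
            Function.update w j v := by
        intro w v
        ext i
        obtain rfl | hi := eq_or_ne i j <;> simp [*]
      have hopen : ∀ (w : ι → M) {O : Set (ι → M)}, zIsOpenV O →
          zIsOpenV {v | Function.update w j v ∈ O} := by
        intro w O hO
        simpa only [hupd] using
          hO.preimage_affine (LinearMap.single ℂ (fun _ : ι => M) j) (Function.update w j 0)
      obtain ⟨v, hv, hvU, hvU'⟩ := hV.exists_mem (hopen z hU) (hopen z' hU')
        ⟨z j, hzV j, by simpa using hz⟩ ⟨z' j, hzV' j, by simpa using hz'⟩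
      refine ⟨_, hvU, _, hvU', fun i => ?_, fun i => ?_, fun i hi => ?_⟩
      · obtain rfl | hi := eq_or_ne i j <;> simp [*]
      · obtain rfl | hi := eq_or_ne i j <;> simp [*]
      · obtain rfl | hij := eq_or_ne i j
        · simp
        · simp [hij, hs i (Finset.mem_of_mem_insert_of_ne hi hij)]
  obtain ⟨z, hz, z', hz', hzV, -, hzz'⟩ := key Finset.univ
  obtain rfl : z = z' := _root_.funext fun i => hzz' i (Finset.mem_univ i)
  exact ⟨z, ⟨hz, hz'⟩, hzV⟩

/-- `P` holds on a nonempty open subset of the power `V ^ ι`. -/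
def IsGeneric (V : Set M) {ι : Type*} (P : (ι → M) → Prop) : Prop :=
  ∃ U : Set (ι → M), zIsOpenV U ∧ (∃ z ∈ U, ∀ i, z i ∈ V) ∧ ∀ z ∈ U, (∀ i, z i ∈ V) → P z

namespace IsGeneric

variable {V : Set M} {ι κ : Type*} {P Q : (ι → M) → Prop}

theorem mono (hP : IsGeneric V P) (h : ∀ z, (∀ i, z i ∈ V) → P z → Q z) : IsGeneric V Q :=
  let ⟨U, hU, hne, hUP⟩ := hP
  ⟨U, hU, hne, fun z hz hzV => h z hzV (hUP z hz hzV)⟩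

theorem exists_mem (hP : IsGeneric V P) : ∃ z, (∀ i, z i ∈ V) ∧ P z :=
  let ⟨_, _, ⟨z, hz, hzV⟩, hUP⟩ := hP
  ⟨z, hzV, hUP z hz hzV⟩

theorem of_forall (hV : V.Nonempty) (h : ∀ z, (∀ i, z i ∈ V) → P z) : IsGeneric V P :=
  ⟨Set.univ, @isOpen_univ _ (ztV _), ⟨fun _ => hV.some, trivial, fun _ => hV.some_mem⟩,
    fun z _ => h z⟩

theorem and [Finite ι] (hV : zIsIrreducibleV V) (hP : IsGeneric V P) (hQ : IsGeneric V Q) :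
    IsGeneric V fun z => P z ∧ Q z := by
  obtain ⟨U, hU, hne, hUP⟩ := hP
  obtain ⟨U', hU', hne', hUQ⟩ := hQ
  exact ⟨U ∩ U', hU.inter hU', hV.exists_mem_pi hU hU' hne hne',
    fun z hz hzV => ⟨hUP z hz.1 hzV, hUQ z hz.2 hzV⟩⟩

theorem forall_mem_finset [Finite ι] (hV : zIsIrreducibleV V) {J : Type*}
    {R : J → (ι → M) → Prop} (s : Finset J) (h : ∀ j ∈ s, IsGeneric V (R j)) :
    IsGeneric V fun z => ∀ j ∈ s, R j z := by
  classical
  induction s using Finset.induction_on with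
  | empty => exact of_forall hV.1 (by simp)
  | insert j s _ ih =>
    simpa only [Finset.forall_mem_insert] using
      and hV (h j (Finset.mem_insert_self j s)) (ih fun i hi => h i (Finset.mem_insert_of_mem hi))

theorem forall_of_finite [Finite ι] (hV : zIsIrreducibleV V) {J : Type*} [Finite J]
    {R : J → (ι → M) → Prop} (h : ∀ j, IsGeneric V (R j)) :
    IsGeneric V fun z => ∀ j, R j z := by
  cases nonempty_fintype J
  simpa using forall_mem_finset hV Finset.univ fun j _ => h j

/-- A generic property of `ι`-tuples holds generically for the subtuples of a `κ`-tuple along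
an injection. -/
theorem comp_injective (hP : IsGeneric V P) (hV : V.Nonempty) {σ : ι → κ}
    (hσ : Function.Injective σ) : IsGeneric V fun z : κ → M => P (z ∘ σ) := by
  obtain ⟨U, hU, ⟨z, hz, hzV⟩, hUP⟩ := hP
  refine ⟨{w | w ∘ σ ∈ U}, hU.preimage_linear (LinearMap.funLeft ℂ M σ),
    ⟨Function.extend σ z fun _ => hV.some, ?_, fun i => ?_⟩,
    fun w hw hwV => hUP _ hw fun i => hwV _⟩
  · rwa [Set.mem_ofPred_eq, Function.extend_comp hσ]
  · by_cases hi : ∃ j, σ j = i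
    · obtain ⟨j, rfl⟩ := hi
      rw [hσ.extend_apply]
      exact hzV j
    · rw [Function.extend_apply' _ _ _ hi]
      exact hV.some_mem

/-- Some slice of a generic property is generic. -/
theorem exists_slice {P : (ι ⊕ κ → M) → Prop} (hP : IsGeneric V P) :
    ∃ u : ι → M, (∀ i, u i ∈ V) ∧ IsGeneric V fun x : κ → M => P (Sum.elim u x) := by
  obtain ⟨U, hU, ⟨z, hz, hzV⟩, hUP⟩ := hP
  let A : (κ → M) →ₗ[ℂ] (ι ⊕ κ → M) := LinearMap.pi (Sum.elim 0 LinearMap.proj)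
  have hA : ∀ x : κ → M, A x + Sum.elim (z ∘ Sum.inl) 0 = Sum.elim (z ∘ Sum.inl) x := by
    intro x
    ext (i | i) <;> simp [A]
  refine ⟨z ∘ Sum.inl, fun i => hzV _, {x | Sum.elim (z ∘ Sum.inl) x ∈ U}, ?_,
    ⟨z ∘ Sum.inr, ?_, fun i => hzV _⟩, fun x hx hxV => hUP _ hx ?_⟩
  · simpa only [hA] using hU.preimage_affine A (Sum.elim (z ∘ Sum.inl) 0)
  · rwa [Set.mem_ofPred_eq, Sum.elim_comp_inl_inr]
  · rintro (i | i)
    exacts [hzV _, hxV i]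

/-- Genericity is preserved by a linear automorphism of the ambient space under which `V` is
stable. -/
theorem comp_linear (hP : IsGeneric V P) {L L' : M →ₗ[ℂ] M} (hLL' : ∀ x, L' (L x) = x)
    (hL : ∀ x ∈ V, L x ∈ V) (hL' : ∀ x ∈ V, L' x ∈ V) :
    IsGeneric V fun z => P fun i => L' (z i) := by
  obtain ⟨U, hU, ⟨z, hz, hzV⟩, hUP⟩ := hP
  refine ⟨{w | (fun i => L' (w i)) ∈ U},
    hU.preimage_linear (LinearMap.pi fun i => L'.comp (LinearMap.proj i)),
    ⟨fun i => L (z i), ?_, fun i => hL _ (hzV i)⟩, fun w hw hwV => hUP _ hw fun i => hL' _ (hwV i)⟩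
  simpa only [Set.mem_ofPred_eq, hLL'] using hz

theorem of_isDenseOpenSubsetV {W : Set (ι → M)} (hV : V.Nonempty)
    (hW : IsDenseOpenSubsetV W {z | ∀ i, z i ∈ V}) : IsGeneric V fun z => z ∈ W := by
  obtain ⟨-, ⟨U, hU, rfl⟩, hcl⟩ := hW
  refine ⟨U, hU, ?_, fun z hz hzV => ⟨hz, hzV⟩⟩
  have hmem : (fun _ => hV.some : ι → M) ∈ zClosureV (U ∩ {z | ∀ i, z i ∈ V}) :=
    hcl fun _ => hV.some_mem
  exact (@closure_nonempty_iff _ (ztV (ι → M)) _).mp ⟨_, hmem⟩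

theorem exists_isDenseOpenSubsetV [Finite ι] (hV : zIsIrreducibleV V) (hP : IsGeneric V P) :
    ∃ Ω : Set (ι → M), IsDenseOpenSubsetV Ω {z | ∀ i, z i ∈ V} ∧ ∀ z ∈ Ω, P z := by
  obtain ⟨U, hU, hne, hUP⟩ := hP
  refine ⟨U ∩ {z | ∀ i, z i ∈ V}, ⟨Set.inter_subset_right, ⟨U, hU, rfl⟩, fun z hz => ?_⟩,
    fun z hz => hUP z hz.1 hz.2⟩
  refine (@mem_closure_iff _ (ztV (ι → M)) _ _).mpr fun O hO hzO => ?_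
  obtain ⟨w, ⟨hwO, hwU⟩, hwV⟩ := hV.exists_mem_pi hO hU ⟨z, hzO, hz⟩ hne
  exact ⟨w, hwO, hwU, hwV⟩

end IsGeneric

end Generic

section Stationarity

variable {M E : Type*} [AddCommGroup M] [Module ℂ M] [AddCommGroup E] [Module ℂ E]

/-- The tuple which takes its first `j` entries from the second family of indices and the other
ones from the first. -/
def hybridIndex (m j : ℕ) (i : Fin m) : (Fin m ⊕ Unit) ⊕ Fin m :=
  if (i : ℕ) < j then Sum.inr i else Sum.inl (Sum.inl i)

theorem hybridIndex_injective (m j : ℕ) : Function.Injective (hybridIndex m j) := by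
  intro i i' h
  simp only [hybridIndex] at h
  split_ifs at h <;> simpa using h

/-- If the generic dimension of `(F x₁ ⊔ ⋯ ⊔ F xₘ) ⊓ F y` is nonzero and does not change when
one more `x` is added, then some nonzero vector lies in `F x₁ ⊔ ⋯ ⊔ F xₘ` for generic `x`. -/
theorem exists_ne_zero_isGeneric_mem [FiniteDimensional ℂ E] {V : Set M}
    (hV : zIsIrreducibleV V) (F : M → Submodule ℂ E) {m a : ℕ} (ha : a ≠ 0)
    (hW : IsGeneric V fun z : Fin (m + 1) → M =>
      Module.finrank ℂ ↥((⨆ i : Fin m, F (z i.castSucc)) ⊓ F (z (Fin.last m))) = a)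
    (hW' : IsGeneric V fun z : Fin (m + 2) → M =>
      Module.finrank ℂ ↥((⨆ i : Fin (m + 1), F (z i.castSucc)) ⊓ F (z (Fin.last (m + 1)))) = a) :
    ∃ f : E, f ≠ 0 ∧ IsGeneric V fun x : Fin m → M => f ∈ ⨆ i, F (x i) := by
  let y : (Fin m ⊕ Unit) ⊕ Fin m := Sum.inl (Sum.inr ())
  have hy : ∀ j, y ∉ Set.range (hybridIndex m j) := by
    rintro j ⟨i, hi⟩
    simp only [hybridIndex, y] at hi
    split_ifs at hi
    simp at hi
  have h1 : ∀ j : ℕ, IsGeneric V fun z : (Fin m ⊕ Unit) ⊕ Fin m → M =>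
      Module.finrank ℂ ↥((⨆ i, F (z (hybridIndex m j i))) ⊓ F (z y)) = a := by
    intro j
    have hinj : Function.Injective (Fin.snoc (hybridIndex m j) y : Fin (m + 1) → _) :=
      Fin.snoc_injective_iff.mpr ⟨hybridIndex_injective m j, hy j⟩
    refine (hW.comp_injective hV.1 hinj).mono fun z _ hz => ?_
    have h : (⨆ i, F (z (hybridIndex m j i))) ⊓ F (z y) = (⨆ i : Fin m,
        F ((z ∘ (Fin.snoc (hybridIndex m j) y : Fin (m + 1) → _)) i.castSucc)) ⊓
        F ((z ∘ (Fin.snoc (hybridIndex m j) y : Fin (m + 1) → _)) (Fin.last m)) := by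
      simp
    rw [h, hz]
  have h2 : ∀ j : Fin m, IsGeneric V fun z : (Fin m ⊕ Unit) ⊕ Fin m → M =>
      Module.finrank ℂ
        ↥(((⨆ i, F (z (hybridIndex m j i))) ⊔ F (z (Sum.inr j))) ⊓ F (z y)) = a := by
    intro j
    have hinj : Function.Injective
        (Fin.snoc (Fin.snoc (hybridIndex m j) (Sum.inr j) : Fin (m + 1) → _) y :
          Fin (m + 2) → _) := by
      refine Fin.snoc_injective_iff.mpr
        ⟨Fin.snoc_injective_iff.mpr ⟨hybridIndex_injective m j, ?_⟩, ?_⟩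
      · rintro ⟨i, hi⟩
        simp only [hybridIndex] at hi
        split_ifs at hi with h
        obtain rfl := Sum.inr_injective hi
        exact lt_irrefl _ h
      · rw [Fin.range_snoc]
        rintro (h | h)
        · simp [y] at h
        · exact hy j h
    refine (hW'.comp_injective hV.1 hinj).mono fun z _ hz => ?_
    set τ : Fin (m + 2) → (Fin m ⊕ Unit) ⊕ Fin m :=
      Fin.snoc (Fin.snoc (hybridIndex m j) (Sum.inr j) : Fin (m + 1) → _) y with hτ
    have hsup : (⨆ i, F (z (hybridIndex m j i))) ⊔ F (z (Sum.inr j)) =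
        ⨆ i : Fin (m + 1), F ((z ∘ τ) i.castSucc) := by
      refine le_antisymm (sup_le (iSup_le fun i => ?_) ?_) (iSup_le fun i => ?_)
      · exact le_iSup_of_le i.castSucc (by simp [hτ])
      · exact le_iSup_of_le (Fin.last m) (by simp [hτ])
      · induction i using Fin.lastCases with
        | last => simp [hτ]
        | cast i => exact le_sup_of_le_left (le_iSup_of_le i (by simp [hτ]))
    have hlast : z y = (z ∘ τ) (Fin.last (m + 1)) := by simp [hτ]
    rw [hsup, hlast, hz]
  have h3 := IsGeneric.and hV (IsGeneric.forall_of_finite hV fun j : Fin (m + 1) => h1 j)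
    (IsGeneric.forall_of_finite hV h2)
  obtain ⟨u, -, hu⟩ := h3.exists_slice
  have h4 : IsGeneric V fun x : Fin m → M =>
      (⨆ i, F (u (Sum.inl i))) ⊓ F (u (Sum.inr ())) ≤ ⨆ i, F (x i) ∧
      Module.finrank ℂ ↥((⨆ i, F (u (Sum.inl i))) ⊓ F (u (Sum.inr ()))) = a := by
    refine hu.mono fun x _ hx => ?_
    obtain ⟨hx1, hx2⟩ := hx
    set z : (Fin m ⊕ Unit) ⊕ Fin m → M := Sum.elim u x
    have hzero : ∀ i, hybridIndex m 0 i = Sum.inl (Sum.inl i) := fun i => by simp [hybridIndex]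
    have hlast : ∀ i, hybridIndex m m i = Sum.inr i := fun i => by simp [hybridIndex]
    have hstep : ∀ j ≤ m, (⨆ i, F (z (hybridIndex m 0 i))) ⊓ F (z y) =
        (⨆ i, F (z (hybridIndex m j i))) ⊓ F (z y) := by
      intro j
      induction j with
      | zero => exact fun _ => rfl
      | succ j ih =>
        intro hj
        have e1 : (⨆ i, F (z (hybridIndex m j i))) ⊓ F (z y) =
            ((⨆ i, F (z (hybridIndex m j i))) ⊔ F (z (Sum.inr ⟨j, hj⟩))) ⊓ F (z y) :=
          Submodule.eq_of_le_of_finrank_eq (inf_le_inf_right _ le_sup_left)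
            ((hx1 ⟨j, by omega⟩).trans (hx2 ⟨j, hj⟩).symm)
        have e2 : (⨆ i, F (z (hybridIndex m (j + 1) i))) ⊓ F (z y) =
            ((⨆ i, F (z (hybridIndex m j i))) ⊔ F (z (Sum.inr ⟨j, hj⟩))) ⊓ F (z y) := by
          refine Submodule.eq_of_le_of_finrank_eq (inf_le_inf_right _ (iSup_le fun i => ?_))
            ((hx1 ⟨j + 1, by omega⟩).trans (hx2 ⟨j, hj⟩).symm)
          obtain hi | hi := eq_or_ne (i : ℕ) j
          · refine le_sup_of_le_right (le_of_eq ?_)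
            obtain rfl : i = ⟨j, hj⟩ := Fin.ext hi
            simp [hybridIndex]
          · refine le_sup_of_le_left (le_iSup_of_le i (le_of_eq ?_))
            have : (i : ℕ) < j + 1 ↔ (i : ℕ) < j := by omega
            simp only [hybridIndex, this]
        rw [ih (by omega), e1, e2]
    have hm := hstep m le_rfl
    have h0 := hx1 0
    simp only [hzero, hlast, Fin.val_zero] at hm h0
    exact ⟨hm.le.trans inf_le_left, h0⟩
  obtain ⟨-, -, -, hrank⟩ := h4.exists_mem
  have hne : (⨆ i, F (u (Sum.inl i))) ⊓ F (u (Sum.inr ())) ≠ ⊥ := fun h =>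
    ha (by rw [← hrank, h, finrank_bot])
  obtain ⟨f, hf, hf0⟩ := Submodule.exists_mem_ne_zero_of_ne_bot hne
  exact ⟨f, hf0, h4.mono fun x _ hx => hx.1 hf⟩

/-- The vectors lying in `G x` for generic `x`. -/
def genericSubmodule {V : Set M} (hV : zIsIrreducibleV V) {ι : Type*} [Finite ι]
    (G : (ι → M) → Submodule ℂ E) : Submodule ℂ E where
  carrier := {f | IsGeneric V fun x => f ∈ G x}
  add_mem' hf hg := (IsGeneric.and hV hf hg).mono fun x _ h => (G x).add_mem h.1 h.2
  zero_mem' := IsGeneric.of_forall hV.1 fun x _ => (G x).zero_mem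
  smul_mem' c _ hf := hf.mono fun x _ h => (G x).smul_mem c h

theorem mem_genericSubmodule {V : Set M} (hV : zIsIrreducibleV V) {ι : Type*} [Finite ι]
    {G : (ι → M) → Submodule ℂ E} {f : E} :
    f ∈ genericSubmodule hV G ↔ IsGeneric V fun x => f ∈ G x :=
  Iff.rfl

/-- If every vector lies in `G x` for generic `x`, then `G x` is generically everything. -/
theorem isGeneric_eq_top [FiniteDimensional ℂ E] {V : Set M} (hV : zIsIrreducibleV V)
    {ι : Type*} [Finite ι] {G : (ι → M) → Submodule ℂ E} (h : genericSubmodule hV G = ⊤) :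
    IsGeneric V fun x => G x = ⊤ := by
  let b := Module.finBasis ℂ E
  have hb : ∀ j, IsGeneric V fun x => b j ∈ G x := fun j =>
    (mem_genericSubmodule hV).mp (h ▸ Submodule.mem_top)
  refine (IsGeneric.forall_of_finite hV hb).mono fun x _ hx => ?_
  rw [eq_top_iff, ← b.span_eq, Submodule.span_le]
  rintro _ ⟨j, rfl⟩
  exact hx j

/-- The restriction of a linear substitution to the forms of degree `e`. -/
def linSubstHomogeneous {n : ℕ} (e : ℕ) (A : Matrix (Fin n) (Fin n) ℂ) :
    homogeneousSubmodule (Fin n) ℂ e →ₗ[ℂ] homogeneousSubmodule (Fin n) ℂ e :=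
  (linSubst A).toLinearMap.restrict fun _ hf => linSubst_isHomogeneous A hf

theorem coe_linSubstHomogeneous {n e : ℕ} (A : Matrix (Fin n) (Fin n) ℂ)
    (f : homogeneousSubmodule (Fin n) ℂ e) :
    (linSubstHomogeneous e A f : MvPolynomial (Fin n) ℂ) = linSubst A f := rfl

theorem linSubstHomogeneous_linSubstHomogeneous_inv {n e : ℕ} (g : GL (Fin n) ℂ)
    (x : homogeneousSubmodule (Fin n) ℂ e) :
    linSubstHomogeneous e g.1 (linSubstHomogeneous e (g⁻¹).1 x) = x := by
  apply Subtype.ext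
  rw [coe_linSubstHomogeneous, coe_linSubstHomogeneous, linSubst_linSubst, ← Units.val_mul,
    inv_mul_cancel, Units.val_one, linSubst_one]

theorem mulSpace_map_linSubstHomogeneous_le {n d k : ℕ} (A : Matrix (Fin n) (Fin n) ℂ)
    (x : MvPolynomial (Fin n) ℂ) :
    (mulSpace n d k x).map (linSubstHomogeneous (d + k) A) ≤ mulSpace n d k (linSubst A x) := by
  rintro _ ⟨f, hf, rfl⟩
  obtain ⟨h, hh, hxh⟩ := mem_mulSpace.mp hf
  exact mem_mulSpace.mpr ⟨linSubst A h, linSubst_isHomogeneous A hh, by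
    rw [coe_linSubstHomogeneous, ← hxh, map_mul]⟩

/-- The forms lying generically in `x₁·S^k ⊔ ⋯ ⊔ xₘ·S^k` make up a `GL`-stable subspace. -/
theorem linSubstHomogeneous_mem_genericSubmodule {n d k m : ℕ}
    {V : Set (homogeneousSubmodule (Fin n) ℂ d)} (hV : zIsIrreducibleV V)
    (hVinv : ∀ (g : GL (Fin n) ℂ), ∀ f ∈ V, linSubstHomogeneous d g.1 f ∈ V) (g : GL (Fin n) ℂ)
    {f : homogeneousSubmodule (Fin n) ℂ (d + k)}
    (hf : f ∈ genericSubmodule hV fun x : Fin m → homogeneousSubmodule (Fin n) ℂ d =>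
      ⨆ i, mulSpace n d k (x i : MvPolynomial (Fin n) ℂ)) :
    linSubstHomogeneous (d + k) g.1 f ∈
      genericSubmodule hV fun x : Fin m → homogeneousSubmodule (Fin n) ℂ d =>
        ⨆ i, mulSpace n d k (x i : MvPolynomial (Fin n) ℂ) := by
  rw [mem_genericSubmodule] at hf ⊢
  refine (hf.comp_linear (fun x => by
    simpa using linSubstHomogeneous_linSubstHomogeneous_inv g⁻¹ x) (hVinv g)
    (hVinv g⁻¹)).mono
    fun x _ hx => ?_
  have hx' := Submodule.mem_map_of_mem (f := linSubstHomogeneous (d + k) g.1) hx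
  rw [Submodule.map_iSup] at hx'
  refine SetLike.le_def.mp (iSup_mono fun i => ?_) hx'
  refine (mulSpace_map_linSubstHomogeneous_le _ _).trans_eq ?_
  rw [← coe_linSubstHomogeneous, linSubstHomogeneous_linSubstHomogeneous_inv]

end Stationarity

theorem stmt_3 (n d k : ℕ) (hn : 1 ≤ n) (hd : 1 ≤ d) (hk : 1 ≤ k)
    (m : ℕ) (hm : 1 ≤ m)
    (V : Set ↥(homogeneousSubmodule (Fin n) ℂ d))
    (hVclosed : zIsClosedV V) (hVirr : zIsIrreducibleV V)
    (hVcone : ∀ (c : ℂ), ∀ x ∈ V, c • x ∈ V)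
    (hV0 : V ≠ {0})
    (hVinv : ∀ (g : GL (Fin n) ℂ), ∀ f ∈ V,
      ∀ h : ↥(homogeneousSubmodule (Fin n) ℂ d),
        (h : MvPolynomial (Fin n) ℂ) = substAction g (f : MvPolynomial (Fin n) ℂ) → h ∈ V)
    (a a' : ℕ)
    (W : Set (Fin (m + 1) → ↥(homogeneousSubmodule (Fin n) ℂ d)))
    (hW : IsDenseOpenSubsetV W { z | ∀ i, z i ∈ V })
    (hWcond : ∀ z ∈ W,
      Module.finrank ℂ
        ↥((⨆ i : Fin m, mulSpace n d k (z i.castSucc : MvPolynomial (Fin n) ℂ)) ⊓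
            mulSpace n d k (z (Fin.last m) : MvPolynomial (Fin n) ℂ)) = a)
    (W' : Set (Fin (m + 2) → ↥(homogeneousSubmodule (Fin n) ℂ d)))
    (hW' : IsDenseOpenSubsetV W' { z | ∀ i, z i ∈ V })
    (hW'cond : ∀ z ∈ W',
      Module.finrank ℂ
        ↥((⨆ i : Fin (m + 1), mulSpace n d k (z i.castSucc : MvPolynomial (Fin n) ℂ)) ⊓
            mulSpace n d k (z (Fin.last (m + 1)) : MvPolynomial (Fin n) ℂ)) = a')
    (haa' : a' = a) (ha : a ≠ 0) :
    a = Nat.choose (n + k - 1) k ∧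
    ∃ Ω : Set (Fin m → ↥(homogeneousSubmodule (Fin n) ℂ d)),
      IsDenseOpenSubsetV Ω { z | ∀ i, z i ∈ V } ∧
      ∀ z ∈ Ω, (⨆ i : Fin m, mulSpace n d k (z i : MvPolynomial (Fin n) ℂ)) = ⊤ := by
  subst haa'
  have hWgen := (IsGeneric.of_isDenseOpenSubsetV hVirr.1 hW).mono fun z _ hz => hWcond z hz
  have hWgen' := (IsGeneric.of_isDenseOpenSubsetV hVirr.1 hW').mono fun z _ hz => hW'cond z hz
  have hinv : ∀ (g : GL (Fin n) ℂ), ∀ f ∈ V, linSubstHomogeneous d g.1 f ∈ V :=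
    fun g f hf => hVinv g f hf _ rfl
  obtain ⟨f, hf0, hf⟩ := exists_ne_zero_isGeneric_mem hVirr
    (fun x => mulSpace n d k (x : MvPolynomial (Fin n) ℂ)) ha hWgen hWgen'
  let U := genericSubmodule hVirr fun x : Fin m → homogeneousSubmodule (Fin n) ℂ d =>
    ⨆ i, mulSpace n d k (x i : MvPolynomial (Fin n) ℂ)
  have hU : U = ⊤ := by
    have hle := homogeneousSubmodule_le_of_substAction_mem (e := d + k)
      (U.map (homogeneousSubmodule (Fin n) ℂ (d + k)).subtype)
      (by
        rintro g _ ⟨h, hh, rfl⟩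
        exact ⟨_, linSubstHomogeneous_mem_genericSubmodule hVirr hinv g hh, rfl⟩)
      ⟨f, hf, rfl⟩ f.2 (fun h => hf0 (Subtype.ext h))
    rw [eq_top_iff]
    intro h _
    obtain ⟨h', hh', heq⟩ := hle h.2
    obtain rfl : h' = h := Subtype.ext heq
    exact hh'
  have htop := isGeneric_eq_top hVirr hU
  refine ⟨?_, htop.exists_isDenseOpenSubsetV hVirr⟩
  obtain ⟨z, -, hz, hzr⟩ := (IsGeneric.and hVirr
    (htop.comp_injective hVirr.1 (Fin.castSucc_injective m)) hWgen).exists_mem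
  simp only [Function.comp_apply] at hz
  rw [hz, top_inf_eq] at hzr
  rw [← hzr]
  refine finrank_mulSpace (z (Fin.last m)).2 fun h0 => ha ?_
  rw [← hzr, h0, Submodule.finrank_eq_zero, eq_bot_iff]
  intro h hh
  obtain ⟨q, -, hq⟩ := mem_mulSpace.mp hh
  rw [zero_mul] at hq
  exact Subtype.ext hq.symm
end
end
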